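/- arXiv:2110.13949 — 6 statements merged into one kernel-verified Lean document; each statement's English description precedes it below -/
import Mathlib

section
/- Let ε be an edge-weight function and υ a vertex-weight function on a finite set V with n = |V|. Let R be a set of edges of G(ε), let V_R be the set of endpoints of edges in R, s = |V_R|, and c the number of connected components of the graph (V_R, R). Let ε_del agree with ε except that ε_del(u,v) = ε_del(v,u) = 0 for every {u,v} ∈ R. Let S ⊆ V with |S| = k be a set of vertices such that d_{ε_del}(v) = 0 for every v ∈ S. Let λ_1 ≤ … ≤ λ_n denote the weighted Laplacian eigenvalues of (ε,υ), and μ_1 ≤ … ≤ μ_{n−k} the weighted Laplacian eigenvalues of (ε_del restricted to V ∖ S, υ restricted to V ∖ S). Then for all 1 ≤ i ≤ n−k: μ_i ≤ λ_{i+k}, and λ_{i−s+c+k} ≤ μ_i whenever i−s+c+k ≥ 1. -/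
open Matrix Polynomial
open scoped Classical

/-- The combinatorial Laplacian of an edge-weight function. -/
noncomputable def lapMat {V : Type} [Fintype V] [DecidableEq V] (ε : V → V → ℝ) :
    Matrix V V ℝ :=
  Matrix.diagonal (fun v => ∑ u, ε v u) - Matrix.of ε

/-- The weighted Laplacian `W(υ)⁻¹ · L(ε)`, whose eigenvalues coincide with those of
the symmetric matrix `W(υ)^{-1/2} L(ε) W(υ)^{-1/2}`. -/
noncomputable def wlap {V : Type} [Fintype V] [DecidableEq V]
    (ε : V → V → ℝ) (υ : V → ℝ) : Matrix V V ℝ :=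
  Matrix.diagonal (fun v => (υ v)⁻¹) * lapMat ε

/-- Two families with the same multiset of values differ by a bijection of their index types. -/
lemma exists_equiv_comp_eq_of_map_univ_eq {α β γ : Type*} [Fintype α] [Fintype β]
    {f : α → γ} {g : β → γ}
    (h : (Finset.univ : Finset α).val.map f = (Finset.univ : Finset β).val.map g) :
    ∃ e : α ≃ β, ∀ a, g (e a) = f a := by
  have hcard : ∀ y, Nonempty ({a // f a = y} ≃ {b // g b = y}) := fun y => by
    refine ⟨Fintype.equivOfCardEq ?_⟩
    have hy := congrArg (Multiset.count y) h
    rw [Multiset.count_map, Multiset.count_map] at hy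
    rw [Fintype.card_subtype, Fintype.card_subtype]
    simpa [Finset.card_def, Finset.filter_val, eq_comm] using hy
  have F := fun y => Classical.choice (hcard y)
  refine ⟨(Equiv.sigmaFiberEquiv f).symm.trans
    ((Equiv.sigmaCongrRight F).trans (Equiv.sigmaFiberEquiv g)), fun a => ?_⟩
  exact (F (f a) ⟨a, rfl⟩).2

/-- Fewer linear conditions than the dimension admit a nonzero common solution. -/
lemma exists_ne_zero_of_card_lt {E ι : Type*} [AddCommGroup E] [Module ℝ E]
    [FiniteDimensional ℝ E] [Fintype ι] (f : ι → E →ₗ[ℝ] ℝ)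
    (h : Fintype.card ι < Module.finrank ℝ E) : ∃ x : E, x ≠ 0 ∧ ∀ i, f i x = 0 := by
  have hker : LinearMap.ker (LinearMap.pi f) ≠ ⊥ :=
    LinearMap.ker_ne_bot_of_finrank_lt (by simpa using h)
  obtain ⟨x, hx, hx0⟩ := (Submodule.ne_bot_iff _).mp hker
  exact ⟨x, hx0, fun i => congrFun (LinearMap.mem_ker.mp hx) i⟩

/-- The quadratic form of the Laplacian, with each unordered pair counted twice. -/
noncomputable def edgeEnergy {V : Type} [Fintype V] (ε : V → V → ℝ) (x : V → ℝ) : ℝ :=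
  ∑ u, ∑ v, ε u v * (x u - x v) ^ 2

lemma two_mul_dotProduct_lapMat {V : Type} [Fintype V] [DecidableEq V] {ε : V → V → ℝ}
    (hsym : ∀ u v, ε u v = ε v u) (x : V → ℝ) :
    2 * (x ⬝ᵥ (lapMat ε *ᵥ x)) = edgeEnergy ε x := by
  have hleft : x ⬝ᵥ (lapMat ε *ᵥ x) = ∑ u, ∑ v, (ε u v * x u ^ 2 - ε u v * (x u * x v)) := by
    rw [lapMat, Matrix.sub_mulVec, dotProduct_sub]
    simp only [dotProduct, Matrix.mulVec_diagonal, Finset.sum_sub_distrib]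
    congr 1
    · refine Finset.sum_congr rfl fun u _ => ?_
      rw [← Finset.sum_mul]; ring
    · refine Finset.sum_congr rfl fun u _ => ?_
      simp only [Matrix.mulVec, dotProduct, Matrix.of_apply, Finset.mul_sum]
      exact Finset.sum_congr rfl fun v _ => by ring
  have hswap : ∑ u, ∑ v, ε u v * x u ^ 2 = ∑ u, ∑ v, ε u v * x v ^ 2 := by
    rw [Finset.sum_comm]
    exact Finset.sum_congr rfl fun u _ => Finset.sum_congr rfl fun v _ => by rw [hsym]
  have hexp : edgeEnergy ε x = ∑ u, ∑ v, ε u v * x u ^ 2 + ∑ u, ∑ v, ε u v * x v ^ 2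
      - 2 * ∑ u, ∑ v, ε u v * (x u * x v) := by
    simp only [edgeEnergy, Finset.mul_sum, ← Finset.sum_add_distrib, ← Finset.sum_sub_distrib]
    exact Finset.sum_congr rfl fun u _ => Finset.sum_congr rfl fun v _ => by ring
  rw [hleft, hexp, ← hswap]
  simp only [Finset.sum_sub_distrib]
  ring

lemma edgeEnergy_nonneg {V : Type} [Fintype V] {ε : V → V → ℝ} (h : ∀ u v, 0 ≤ ε u v)
    (x : V → ℝ) : 0 ≤ edgeEnergy ε x :=
  Finset.sum_nonneg fun u _ => Finset.sum_nonneg fun v _ => mul_nonneg (h u v) (sq_nonneg _)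

lemma edgeEnergy_mono {V : Type} [Fintype V] {ε ε' : V → V → ℝ} (h : ∀ u v, ε u v ≤ ε' u v)
    (x : V → ℝ) : edgeEnergy ε x ≤ edgeEnergy ε' x :=
  Finset.sum_le_sum fun u _ => Finset.sum_le_sum fun v _ =>
    mul_le_mul_of_nonneg_right (h u v) (sq_nonneg _)

lemma sum_notMem_eq_sum {V : Type} [Fintype V] (S : Finset V) [Fintype {v // v ∉ S}] {g : V → ℝ}
    (hg : ∀ v ∈ S, g v = 0) : ∑ a : {v // v ∉ S}, g a.1 = ∑ v, g v := by
  rw [← Finset.sum_subtype (Finset.univ.filter (· ∉ S)) (by simp) g]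
  exact Finset.sum_subset (Finset.subset_univ _) fun v _ hv => hg v (by simpa using hv)

/-- Isolated vertices do not contribute to the energy. -/
lemma edgeEnergy_restrict {V : Type} [Fintype V] {ε : V → V → ℝ} (S : Finset V)
    [Fintype {v // v ∉ S}] (hS : ∀ u v, u ∈ S ∨ v ∈ S → ε u v = 0) (x : V → ℝ) :
    edgeEnergy (fun a b : {v // v ∉ S} => ε a.1 b.1) (fun a => x a.1) = edgeEnergy ε x := by
  unfold edgeEnergy
  rw [← sum_notMem_eq_sum S (g := fun u => ∑ v, ε u v * (x u - x v) ^ 2)]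
  · refine Finset.sum_congr rfl fun a _ =>
      sum_notMem_eq_sum S (g := fun v => ε a.1 v * (x a.1 - x v) ^ 2) ?_
    intro v hv
    simp [hS a.1 v (Or.inr hv)]
  · intro u hu
    exact Finset.sum_eq_zero fun v _ => by simp [hS u v (Or.inl hu)]

/-- Simultaneous diagonalization of the vertex-weighted norm and the Laplacian form: the
coordinate functionals of an orthonormal eigenbasis of the weighted Laplacian. -/
lemma exists_eigencoordinates {V : Type} [Fintype V] [DecidableEq V] {ε : V → V → ℝ}
    (hsym : ∀ u v, ε u v = ε v u) {υ : V → ℝ} (hυ : ∀ v, 0 < υ v) {m : ℕ} {lam : Fin m → ℝ}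
    (hlam : (wlap ε υ).charpoly = ∏ i, (X - C (lam i))) :
    ∃ c : Fin m → (V → ℝ) →ₗ[ℝ] ℝ, ∀ x : V → ℝ,
      (∑ v, υ v * x v ^ 2 = ∑ i, c i x ^ 2) ∧
      edgeEnergy ε x = 2 * ∑ i, lam i * c i x ^ 2 := by
  have hw : ∀ v, √(υ v) ≠ 0 := fun v => (Real.sqrt_pos.mpr (hυ v)).ne'
  set D : Matrix V V ℝ := diagonal fun v => √(υ v) with hD
  set D' : Matrix V V ℝ := diagonal fun v => (√(υ v))⁻¹ with hD'
  set B : Matrix V V ℝ := D' * lapMat ε * D' with hBdef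
  have hDD' : D' * D = 1 := by
    rw [hD, hD', diagonal_mul_diagonal, ← diagonal_one]
    exact congrArg _ (funext fun v => inv_mul_cancel₀ (hw v))
  have hLT : (lapMat ε)ᵀ = lapMat ε := by
    rw [lapMat, transpose_sub, diagonal_transpose]
    congr 1
    ext u v
    exact hsym v u
  have hB : B.IsHermitian := by
    rw [Matrix.IsHermitian, conjTranspose_eq_transpose_of_trivial, hBdef, transpose_mul,
      transpose_mul, hLT, hD', diagonal_transpose, Matrix.mul_assoc]
  have hchar : B.charpoly = (wlap ε υ).charpoly := by
    rw [hBdef, charpoly_mul_comm, ← Matrix.mul_assoc, wlap, hD', diagonal_mul_diagonal]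
    congr 3
    funext v
    rw [← mul_inv, Real.mul_self_sqrt (hυ v).le]
  have hval : (Finset.univ : Finset (Fin m)).val.map lam
      = (Finset.univ : Finset V).val.map hB.eigenvalues := by
    have h1 := hB.roots_charpoly_eq_eigenvalues
    rw [hchar, hlam, Polynomial.roots_prod _ _
      (by simp [Finset.prod_ne_zero_iff, Polynomial.X_sub_C_ne_zero])] at h1
    simpa [Function.comp_def] using h1
  obtain ⟨e, he⟩ := exists_equiv_comp_eq_of_map_univ_eq hval
  set U : Matrix V V ℝ := (hB.eigenvectorUnitary : Matrix V V ℝ)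
  have hUU : U * Uᵀ = 1 := by
    have := Unitary.coe_mul_star_self hB.eigenvectorUnitary
    rwa [Unitary.coe_star, star_eq_conjTranspose,
      conjTranspose_eq_transpose_of_trivial] at this
  have hspec : B = U * diagonal hB.eigenvalues * Uᵀ := by
    have := hB.spectral_theorem
    rw [Unitary.conjStarAlgAut_apply, star_eq_conjTranspose,
      conjTranspose_eq_transpose_of_trivial] at this
    exact this
  refine ⟨fun i => LinearMap.proj (e i) ∘ₗ (Uᵀ * D).mulVecLin, fun x => ?_⟩
  have hc : ∀ (w : V → ℝ), ∑ i, w (e i) * ((LinearMap.proj (e i) ∘ₗ (Uᵀ * D).mulVecLin) x) ^ 2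
      = x ⬝ᵥ ((D * U * diagonal w * Uᵀ * D) *ᵥ x) := by
    intro w
    have hfac : D * U * diagonal w * Uᵀ * D = (Uᵀ * D)ᵀ * (diagonal w * (Uᵀ * D)) := by
      rw [transpose_mul, transpose_transpose, hD, diagonal_transpose]
      simp only [Matrix.mul_assoc]
    rw [hfac, ← mulVec_mulVec, ← mulVec_mulVec, dotProduct_mulVec, vecMul_transpose,
      Equiv.sum_comp e (fun v => w v * ((LinearMap.proj v ∘ₗ (Uᵀ * D).mulVecLin) x) ^ 2)]
    simp only [dotProduct, mulVec_diagonal]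
    refine Finset.sum_congr rfl fun v _ => ?_
    simp only [LinearMap.comp_apply, LinearMap.proj_apply, mulVecLin_apply]
    ring
  constructor
  · have h1 := hc (fun _ => 1)
    simp only [one_mul] at h1
    rw [h1, diagonal_one, Matrix.mul_one, Matrix.mul_assoc D, hUU, Matrix.mul_one, hD,
      diagonal_mul_diagonal]
    simp only [dotProduct, mulVec_diagonal]
    refine Finset.sum_congr rfl fun v _ => ?_
    rw [Real.mul_self_sqrt (hυ v).le]
    ring
  · have h1 := hc hB.eigenvalues
    simp only [he] at h1
    have hDBD : D * U * diagonal hB.eigenvalues * Uᵀ * D = lapMat ε := by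
      have hcomm : D * D' = 1 := mul_eq_one_comm.mp hDD'
      calc D * U * diagonal hB.eigenvalues * Uᵀ * D
          = D * (U * diagonal hB.eigenvalues * Uᵀ) * D := by simp only [Matrix.mul_assoc]
        _ = D * (D' * lapMat ε * D') * D := by rw [← hspec]
        _ = (D * D') * lapMat ε * (D' * D) := by simp only [Matrix.mul_assoc]
        _ = lapMat ε := by rw [hcomm, hDD', Matrix.one_mul, Matrix.mul_one]
    rw [h1, hDBD, two_mul_dotProduct_lapMat hsym]

lemma sum_weight_mul_sq_pos {V : Type} [Fintype V] {υ : V → ℝ} (hυ : ∀ v, 0 < υ v)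
    {x : V → ℝ} (hx : x ≠ 0) : 0 < ∑ v, υ v * x v ^ 2 := by
  obtain ⟨v, hv⟩ := Function.ne_iff.mp hx
  exact Finset.sum_pos' (fun u _ => mul_nonneg (hυ u).le (sq_nonneg _))
    ⟨v, Finset.mem_univ v, mul_pos (hυ v) (sq_pos_of_ne_zero hv)⟩

lemma sum_mul_sq_le_of_monotone {m : ℕ} {lam : Fin m → ℝ} (hlam : Monotone lam) (j : Fin m)
    {a : Fin m → ℝ} (ha : ∀ i, j < i → a i = 0) :
    ∑ i, lam i * a i ^ 2 ≤ lam j * ∑ i, a i ^ 2 := by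
  rw [Finset.mul_sum]
  refine Finset.sum_le_sum fun i _ => ?_
  rcases le_or_gt i j with h | h
  · exact mul_le_mul_of_nonneg_right (hlam h) (sq_nonneg _)
  · simp [ha i h]

lemma le_sum_mul_sq_of_monotone {m : ℕ} {lam : Fin m → ℝ} (hlam : Monotone lam) (j : Fin m)
    {a : Fin m → ℝ} (ha : ∀ i, i < j → a i = 0) :
    lam j * ∑ i, a i ^ 2 ≤ ∑ i, lam i * a i ^ 2 := by
  rw [Finset.mul_sum]
  refine Finset.sum_le_sum fun i _ => ?_
  rcases le_or_gt j i with h | h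
  · exact mul_le_mul_of_nonneg_right (hlam h) (sq_nonneg _)
  · simp [ha i h]

/-- The eigenvalues of a weighted Laplacian are nonnegative. -/
lemma wlap_eigenvalue_nonneg {V : Type} [Fintype V] [DecidableEq V] {ε : V → V → ℝ}
    (hsym : ∀ u v, ε u v = ε v u) (hnonneg : ∀ u v, 0 ≤ ε u v)
    {υ : V → ℝ} (hυ : ∀ v, 0 < υ v) {m : ℕ} {lam : Fin m → ℝ}
    (hlam : (wlap ε υ).charpoly = ∏ i, (X - C (lam i))) (i : Fin m) : 0 ≤ lam i := by
  obtain ⟨c, hc⟩ := exists_eigencoordinates hsym hυ hlam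
  have hm : m = Fintype.card V := by
    have := congrArg natDegree hlam
    rw [charpoly_natDegree_eq_dim, natDegree_prod_of_monic _ _ fun i _ => monic_X_sub_C _] at this
    simpa using this.symm
  obtain ⟨x, hx0, hx⟩ := exists_ne_zero_of_card_lt (fun l : {l : Fin m // l ≠ i} => c l) (by
    rw [Module.finrank_fintype_fun_eq_card, ← hm]
    have := i.2
    simp only [ne_eq, Fintype.card_subtype_compl, Fintype.card_fin, Fintype.card_unique]
    omega)
  have hzero : ∀ l, l ≠ i → c l x = 0 := fun l hl => hx ⟨l, hl⟩
  obtain ⟨hN, hE⟩ := hc x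
  have hpos := sum_weight_mul_sq_pos hυ hx0
  rw [Finset.sum_eq_single i (fun l _ hl => by simp [hzero l hl]) (by simp)] at hN hE
  have := edgeEnergy_nonneg hnonneg x
  rw [hN] at hpos
  rw [hE] at this
  by_contra! hneg
  nlinarith

/-- The subspace of functions constant on the components of a graph is cut out, on a set of
vertices meeting `p` components, by `card - p` equations between vertices of one component. -/
lemma exists_component_representatives {V : Type} [DecidableEq V] (G : SimpleGraph V)
    [DecidableEq G.ConnectedComponent] (W : Finset V) :
    ∃ (T : Finset V) (g : V → V),
      T.card + (W.image G.connectedComponentMk).card = W.card ∧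
      ∀ x : V → ℝ, (∀ v ∈ T, x v = x (g v)) →
        ∀ u ∈ W, ∀ v ∈ W, G.Adj u v → x u = x v := by
  obtain ⟨T, hTW, hinj, himg⟩ := Finset.exists_subset_injOn_image_eq_of_surjOn
    (f := G.connectedComponentMk) (W : Set V) (W.image G.connectedComponentMk)
    (by simpa using Set.surjOn_image _ _)
  have hrep : ∀ v, ∃ r, v ∈ W → r ∈ T ∧ G.connectedComponentMk r = G.connectedComponentMk v := by
    intro v
    by_cases hv : v ∈ W
    · have hmem : G.connectedComponentMk v ∈ T.image G.connectedComponentMk :=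
        himg ▸ Finset.mem_image_of_mem _ hv
      obtain ⟨r, hr, hrv⟩ := Finset.mem_image.mp hmem
      exact ⟨r, fun _ => ⟨hr, hrv⟩⟩
    · exact ⟨v, fun h => absurd h hv⟩
  choose g hg using hrep
  have hTW' : T ⊆ W := Finset.coe_subset.mp hTW
  refine ⟨W \ T, g, ?_, fun x hx => ?_⟩
  · rw [← himg, Finset.card_image_of_injOn hinj]
    exact Finset.card_sdiff_add_card_eq_card hTW'
  · have hxg : ∀ v ∈ W, x v = x (g v) := by
      intro v hv
      by_cases hvT : v ∈ T
      · rw [hinj (hg v hv).1 hvT (hg v hv).2]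
      · exact hx v (Finset.mem_sdiff.mpr ⟨hv, hvT⟩)
    intro u hu v hv huv
    rw [hxg u hu, hxg v hv]
    refine congrArg x (hinj (hg u hu).1 (hg v hv).1 ?_)
    rw [(hg u hu).2, (hg v hv).2]
    exact SimpleGraph.ConnectedComponent.sound huv.reachable

/-- **Subgraph deletion interlacing** for the weighted Laplacian:
`μᵢ ≤ λ_{i+k}` and `λ_{i-s+c+k} ≤ μᵢ` whenever `i-s+c+k ≥ 1`. -/
theorem interlacing_subgraph_deletion
    {V : Type} [Fintype V] [DecidableEq V]
    (ε : V → V → ℝ) (hsym : ∀ u v, ε u v = ε v u)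
    (hnonneg : ∀ u v, 0 ≤ ε u v) (hdiag : ∀ v, ε v v = 0)
    (υ : V → ℝ) (hυ : ∀ v, 0 < υ v)
    (n : ℕ) (hn : n = Fintype.card V)
    (εe : Sym2 V → ℝ) (hεe : εe = Sym2.lift ⟨ε, fun a b => hsym a b⟩)
    (R : Finset (Sym2 V)) (hR : ∀ e ∈ R, ¬ e.IsDiag ∧ 0 < εe e)
    (VR : Finset V) (hVR : VR = Finset.univ.filter (fun v => ∃ e ∈ R, v ∈ e))
    (s : ℕ) (hs : s = VR.card)
    (c : ℕ)
    (hc : c = (VR.image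
      (SimpleGraph.fromEdgeSet (↑R : Set (Sym2 V))).connectedComponentMk).card)
    (εdel : V → V → ℝ)
    (hdel : εdel = fun u v => if s(u, v) ∈ R then 0 else ε u v)
    (S : Finset V) (k : ℕ) (hk : k = S.card)
    (hS : ∀ v ∈ S, ∑ u, εdel v u = 0)
    (lam : Fin n → ℝ) (hlamMono : Monotone lam)
    (hlam : (wlap ε υ).charpoly = ∏ i, (X - C (lam i)))
    (mu : Fin (n - k) → ℝ) (hmuMono : Monotone mu)
    (hmu : (wlap (fun x y : {v // v ∉ S} => εdel x.1 y.1) (fun x => υ x.1)).charpoly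
        = ∏ i, (X - C (mu i))) :
    (∀ i : Fin (n - k), mu i ≤ lam ⟨(i : ℕ) + k, by have := i.2; omega⟩) ∧
    (∀ (i : Fin (n - k)) (j : Fin n),
        (j : ℕ) + 1 + s = (i : ℕ) + 1 + c + k → lam j ≤ mu i) := by
  have hdel_apply : ∀ u v, εdel u v = if s(u, v) ∈ R then 0 else ε u v := fun u v => by rw [hdel]
  have hdel_sym : ∀ u v, εdel u v = εdel v u := fun u v => by
    rw [hdel_apply, hdel_apply, Sym2.eq_swap, hsym]
  have hdel_nonneg : ∀ u v, 0 ≤ εdel u v := fun u v => by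
    rw [hdel_apply]
    split_ifs
    exacts [le_rfl, hnonneg u v]
  have hdel_le : ∀ u v, εdel u v ≤ ε u v := fun u v => by
    rw [hdel_apply]
    split_ifs
    exacts [hnonneg u v, le_rfl]
  have hisolated : ∀ u v, u ∈ S ∨ v ∈ S → εdel u v = 0 := by
    have hrow : ∀ u ∈ S, ∀ v, εdel u v = 0 := fun u hu v =>
      (Finset.sum_eq_zero_iff_of_nonneg fun w _ => hdel_nonneg u w).mp (hS u hu) v
        (Finset.mem_univ v)
    rintro u v (h | h)
    · exact hrow u h v
    · rw [hdel_sym]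
      exact hrow v h u
  have hkn : k ≤ n := by
    rw [hk, hn]
    exact S.card_le_univ
  obtain ⟨a, ha⟩ := exists_eigencoordinates hsym hυ hlam
  obtain ⟨b, hb⟩ := exists_eigencoordinates
    (fun x y : {v // v ∉ S} => hdel_sym x.1 y.1) (fun x => hυ x.1) hmu
  have hmu_nonneg := wlap_eigenvalue_nonneg
    (fun x y : {v // v ∉ S} => hdel_sym x.1 y.1) (fun x y => hdel_nonneg x.1 y.1)
    (fun x => hυ x.1) hmu
  set ρ : (V → ℝ) →ₗ[ℝ] ({v // v ∉ S} → ℝ) := LinearMap.funLeft ℝ ℝ Subtype.val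
  let π : V → (V → ℝ) →ₗ[ℝ] ℝ := fun v => LinearMap.proj v
  have hρE : ∀ x, 2 * ∑ l, mu l * b l (ρ x) ^ 2 = edgeEnergy εdel x := fun x => by
    rw [← (hb (ρ x)).2]
    exact edgeEnergy_restrict S hisolated x
  refine ⟨fun i => ?_, fun i j hij => ?_⟩
  · set j : Fin n := ⟨(i : ℕ) + k, by have := i.2; omega⟩
    obtain ⟨x, hx0, hx⟩ := exists_ne_zero_of_card_lt
      (Sum.elim (fun v : {v // v ∈ S} => π v.1)
        (Sum.elim (fun l : {l : Fin (n - k) // l < i} => b l ∘ₗ ρ)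
          (fun l : {l : Fin n // j < l} => a l))) (by
      have h1 : Fintype.card {l : Fin (n - k) // l < i} = i := by
        rw [Fintype.card_of_subtype (Finset.Iio i) fun _ => Finset.mem_Iio, Fin.card_Iio]
      have h2 : Fintype.card {l : Fin n // j < l} = n - 1 - (i + k) := by
        rw [Fintype.card_of_subtype (Finset.Ioi j) fun _ => Finset.mem_Ioi, Fin.card_Ioi]
      rw [Module.finrank_fintype_fun_eq_card, ← hn, Fintype.card_sum, Fintype.card_sum, h1, h2,
        Fintype.card_coe, ← hk]
      have := i.2
      omega)
    have hxS : ∀ v ∈ S, x v = 0 := fun v hv => hx (Sum.inl ⟨v, hv⟩)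
    have hxb : ∀ l, l < i → b l (ρ x) = 0 := fun l hl => hx (Sum.inr (Sum.inl ⟨l, hl⟩))
    have hxa : ∀ l, j < l → a l x = 0 := fun l hl => hx (Sum.inr (Sum.inr ⟨l, hl⟩))
    have hpos := sum_weight_mul_sq_pos hυ hx0
    have hnorm : ∑ l, b l (ρ x) ^ 2 = ∑ v, υ v * x v ^ 2 := by
      rw [← (hb (ρ x)).1]
      exact sum_notMem_eq_sum S (g := fun v => υ v * x v ^ 2) fun v hv => by simp [hxS v hv]
    have hupper := sum_mul_sq_le_of_monotone hlamMono j hxa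
    have hlower := le_sum_mul_sq_of_monotone hmuMono i hxb
    rw [← (ha x).1] at hupper
    rw [hnorm] at hlower
    have hmono := edgeEnergy_mono hdel_le x
    rw [← hρE, (ha x).2] at hmono
    exact le_of_mul_le_mul_right (by linarith) hpos
  · obtain ⟨T, g, hTcard, hT⟩ := exists_component_representatives
      (SimpleGraph.fromEdgeSet (↑R : Set (Sym2 V))) VR
    rw [← hc, ← hs] at hTcard
    obtain ⟨x, hx0, hx⟩ := exists_ne_zero_of_card_lt
      (Sum.elim (fun v : {v // v ∈ T} => π v.1 - π (g v.1))
        (Sum.elim (fun l : {l : Fin (n - k) // i < l} => b l ∘ₗ ρ)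
          (fun l : {l : Fin n // l < j} => a l))) (by
      have h1 : Fintype.card {l : Fin (n - k) // i < l} = n - k - 1 - i := by
        rw [Fintype.card_of_subtype (Finset.Ioi i) fun _ => Finset.mem_Ioi, Fin.card_Ioi]
      have h2 : Fintype.card {l : Fin n // l < j} = j := by
        rw [Fintype.card_of_subtype (Finset.Iio j) fun _ => Finset.mem_Iio, Fin.card_Iio]
      rw [Module.finrank_fintype_fun_eq_card, ← hn, Fintype.card_sum, Fintype.card_sum, h1, h2,
        Fintype.card_coe]
      have := i.2
      have := j.2
      omega)
    have hxT : ∀ v ∈ T, x v = x (g v) := fun v hv =>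
      (sub_eq_zero (a := π v x)).mp (hx (Sum.inl ⟨v, hv⟩))
    have hxb : ∀ l, i < l → b l (ρ x) = 0 := fun l hl => hx (Sum.inr (Sum.inl ⟨l, hl⟩))
    have hxa : ∀ l, l < j → a l x = 0 := fun l hl => hx (Sum.inr (Sum.inr ⟨l, hl⟩))
    have hpos := sum_weight_mul_sq_pos hυ hx0
    have henergy : edgeEnergy εdel x = edgeEnergy ε x := by
      refine Finset.sum_congr rfl fun u _ => Finset.sum_congr rfl fun v _ => ?_
      rw [hdel_apply]
      split_ifs with huv
      · have hne : u ≠ v := fun h => (hR _ huv).1 (by simp [h])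
        have hxuv : x u = x v := hT x hxT u
          (by rw [hVR]; simpa using ⟨_, huv, Sym2.mem_mk_left u v⟩) v
          (by rw [hVR]; simpa using ⟨_, huv, Sym2.mem_mk_right u v⟩)
          ((SimpleGraph.fromEdgeSet_adj _).mpr ⟨by exact_mod_cast huv, hne⟩)
        simp [hxuv]
      · rfl
    have hnorm : ∑ l, b l (ρ x) ^ 2 ≤ ∑ v, υ v * x v ^ 2 := by
      rw [← (hb (ρ x)).1]
      refine (Finset.sum_subtype (Finset.univ.filter (· ∉ S)) (p := (· ∉ S)) (by simp)
        (fun v => υ v * x v ^ 2)).symm.trans_le ?_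
      exact Finset.sum_le_sum_of_subset_of_nonneg (Finset.subset_univ _)
        fun v _ _ => mul_nonneg (hυ v).le (sq_nonneg _)
    have hupper := sum_mul_sq_le_of_monotone hmuMono i hxb
    have hlower := le_sum_mul_sq_of_monotone hlamMono j hxa
    have hscale := mul_le_mul_of_nonneg_left hnorm (hmu_nonneg i)
    rw [← (ha x).1] at hlower
    rw [← hρE, (ha x).2] at henergy
    exact le_of_mul_le_mul_right (by linarith) hpos
end

section
/- Let ε be an edge-weight function and υ a vertex-weight function on a finite set V, let v₀ ∈ V with d_ε(v₀) > 0, and let η > 0. Let υ' agree with υ except that υ'(v₀) = υ(v₀) + η. Define the star-mesh reduction ε/v₀ on V ∖ {v₀} by (ε/v₀)(x,y) = ε(x,y) + ε(x,v₀)·ε(v₀,y)/d_ε(v₀) for distinct x,y ∈ V ∖ {v₀}, and (ε/v₀)(x,x) = 0. Then, as polynomials in t, det(t·W(υ) − L(ε)) = (υ(v₀)/(υ(v₀)+η)) · det(t·W(υ') − L(ε)) − (η/(υ(v₀)+η)) · d_ε(v₀) · det(t·W(υ|_{V∖{v₀}}) − L(ε/v₀)). -/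
open Matrix Polynomial
open scoped Classical

/-- The polynomial `det (t • W(υ) - L(ε))`. -/
noncomputable def Ppoly {V : Type} [Fintype V] [DecidableEq V]
    (ε : V → V → ℝ) (υ : V → ℝ) : Polynomial ℝ :=
  Matrix.det (Matrix.of fun u v =>
    Polynomial.X * Polynomial.C (Matrix.diagonal υ u v)
      - Polynomial.C (lapMat ε u v))

/-- Expansion of a determinant by the Schur complement of an invertible diagonal entry. -/
theorem det_eq_mul_det_schur {R V : Type*} [CommRing R] [Fintype V] [DecidableEq V]
    (M : Matrix V V R) (v₀ : V) (b : R) (hb : M v₀ v₀ * b = 1) :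
    M.det = M v₀ v₀ * Matrix.det (Matrix.of fun x y : {x : V // x ≠ v₀} =>
      M x.1 y.1 - M x.1 v₀ * b * M v₀ y.1) := by
  let e := Equiv.sumCompl (fun x : V => x = v₀)
  let A : Matrix {x : V // x = v₀} {x : V // x = v₀} R := Matrix.of fun x y => M x.1 y.1
  let B : Matrix {x : V // x = v₀} {x : V // ¬ x = v₀} R := Matrix.of fun x y => M x.1 y.1
  let C : Matrix {x : V // ¬ x = v₀} {x : V // x = v₀} R := Matrix.of fun x y => M x.1 y.1
  let D : Matrix {x : V // ¬ x = v₀} {x : V // ¬ x = v₀} R := Matrix.of fun x y => M x.1 y.1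
  let A' : Matrix {x : V // x = v₀} {x : V // x = v₀} R := Matrix.of fun _ _ => b
  have hAA' : A * A' = 1 := by
    ext ⟨i, rfl⟩ ⟨j, rfl⟩
    simpa [A, A', Matrix.mul_apply, (default : {x : V // x = j}).2] using hb
  have hM : M.submatrix e e = fromBlocks A B C D := by
    ext (i | i) (j | j) <;> rfl
  let : Invertible A := ⟨A', mul_eq_one_comm.mp hAA', hAA'⟩
  have hinv : ⅟A = A' := rfl
  rw [← Matrix.det_submatrix_equiv_self e M, hM, Matrix.det_fromBlocks₁₁, Matrix.det_unique, hinv]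
  congr 2
  ext i j
  simp [A', B, C, D, Matrix.mul_apply, (default : {x : V // x = v₀}).2]

/-- The vertex weight at `v₀` enters `Ppoly` affinely. -/
theorem Ppoly_eq_add_of_eq_off {V : Type} [Fintype V] [DecidableEq V]
    (ε : V → V → ℝ) (υ : V → ℝ) (v₀ : V) :
    ∃ B : ℝ[X], ∀ υ' : V → ℝ, (∀ x, x ≠ v₀ → υ' x = υ x) →
      Ppoly ε υ' = Ppoly ε (Function.update υ v₀ 0) + X * C (υ' v₀) * B := by
  let M : Matrix V V ℝ[X] := Matrix.of fun u v =>
    X * C (Matrix.diagonal (Function.update υ v₀ 0) u v) - C (lapMat ε u v)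
  refine ⟨(M.updateRow v₀ (Pi.single v₀ 1)).det, fun υ' h => ?_⟩
  have hM : Ppoly ε υ' =
      (M.updateRow v₀ (M v₀ + (X * C (υ' v₀)) • Pi.single v₀ 1)).det := by
    unfold Ppoly
    congr 1
    ext1 u v
    by_cases hu : u = v₀
    · subst hu
      by_cases hv : u = v
      · subst hv
        simp [M]
        ring
      · simp [M, hv, Ne.symm hv]
    · by_cases hv : u = v
      · subst hv
        simp [M, hu, h]
      · simp [M, hu, hv]
  rw [hM, Matrix.det_updateRow_add, Matrix.det_updateRow_smul, Matrix.updateRow_eq_self]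
  rfl

/-- With vanishing weight at `v₀`, the polynomial is that of the star-mesh reduction
up to a factor. -/
theorem Ppoly_update_zero {V : Type} [Fintype V] [DecidableEq V]
    (ε : V → V → ℝ) (hdiag : ∀ v, ε v v = 0)
    (υ : V → ℝ) (v₀ : V) (hv₀ : ∑ u, ε v₀ u ≠ 0) :
    Ppoly ε (Function.update υ v₀ 0) = -C (∑ u, ε v₀ u) *
      Ppoly (fun x y : {x : V // x ≠ v₀} => if x = y then 0
        else ε x.1 y.1 + ε x.1 v₀ * ε v₀ y.1 / (∑ u, ε v₀ u)) (fun x => υ x.1) := by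
  set d := ∑ u, ε v₀ u with hd
  have hdiag₀ : (X * C (Matrix.diagonal (Function.update υ v₀ 0) v₀ v₀) - C (lapMat ε v₀ v₀) :
      ℝ[X]) = -C d := by
    simp [lapMat, hdiag, hd]
  have hsum (f : V → ℝ) : ∑ y : {x : V // x ≠ v₀}, f y.1 = ∑ y, f y - f v₀ := by
    rw [Fintype.sum_eq_add_sum_subtype_ne f v₀]
    ring
  have hunit : -C d * -C d⁻¹ = (1 : ℝ[X]) := by
    rw [neg_mul_neg, ← C_mul, mul_inv_cancel₀ hv₀, C_1]
  unfold Ppoly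
  rw [det_eq_mul_det_schur _ v₀ (-C d⁻¹) (by rw [Matrix.of_apply, hdiag₀, hunit]),
    Matrix.of_apply, hdiag₀]
  congr 2
  ext1 x y
  have hx : x.1 ≠ v₀ := x.2
  have hy : y.1 ≠ v₀ := y.2
  by_cases hxy : x = y
  · subst hxy
    have hrow : ∑ y : {x : V // x ≠ v₀}, (if x = y then 0
        else ε x.1 y.1 + ε x.1 v₀ * ε v₀ y.1 / d) = ∑ u, ε x.1 u - ε x.1 v₀ * ε v₀ x.1 / d := by
      have hterm (y : {x : V // x ≠ v₀}) : (if x = y then 0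
          else ε x.1 y.1 + ε x.1 v₀ * ε v₀ y.1 / d) =
          (ε x.1 y.1 + ε x.1 v₀ * ε v₀ y.1 / d) -
            if x = y then ε x.1 v₀ * ε v₀ x.1 / d else 0 := by
        split_ifs with h
        · subst h
          simp [hdiag]
        · simp
      rw [Finset.sum_congr rfl fun y _ => hterm y, Finset.sum_sub_distrib,
        hsum fun y => ε x.1 y + ε x.1 v₀ * ε v₀ y / d, Finset.sum_add_distrib,
        ← Finset.sum_div, ← Finset.mul_sum, ← hd, Finset.sum_ite_eq]
      simp [hdiag]
      field_simp
      ring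
    simp only [Matrix.of_apply, lapMat, Matrix.sub_apply, Matrix.diagonal_apply_eq, hrow,
      Matrix.diagonal_apply_ne _ hx, Matrix.diagonal_apply_ne _ hx.symm, hdiag,
      Function.update_of_ne hx]
    simp only [if_true, div_eq_mul_inv, C_sub, C_mul, C_0]
    ring
  · have hxy' : x.1 ≠ y.1 := fun h => hxy (Subtype.ext h)
    simp only [Matrix.of_apply, lapMat, Matrix.sub_apply, Matrix.diagonal_apply_ne _ hx,
      Matrix.diagonal_apply_ne _ hy.symm, Matrix.diagonal_apply_ne _ hxy,
      Matrix.diagonal_apply_ne _ hxy', if_neg hxy, div_eq_mul_inv, C_sub, C_add, C_mul, C_0]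
    ring

/-- **Addition-reduction**: a vertex analogue of deletion-contraction relating
`P_(G,υ,ε)` to the polynomial with increased weight at `v₀` and to the star-mesh
reduction at `v₀`. -/
theorem addition_reduction
    {V : Type} [Fintype V] [DecidableEq V]
    (ε : V → V → ℝ) (hsym : ∀ u v, ε u v = ε v u)
    (hnonneg : ∀ u v, 0 ≤ ε u v) (hdiag : ∀ v, ε v v = 0)
    (υ : V → ℝ) (hυ : ∀ v, 0 < υ v)
    (v₀ : V) (hv₀ : 0 < ∑ u, ε v₀ u)
    (η : ℝ) (hη : 0 < η)
    (υ' : V → ℝ) (hυ'v : υ' v₀ = υ v₀ + η) (hυ'eq : ∀ x, x ≠ v₀ → υ' x = υ x)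
    (εred : {x : V // x ≠ v₀} → {x : V // x ≠ v₀} → ℝ)
    (hred : εred = fun x y => if x = y then 0
      else ε x.1 y.1 + ε x.1 v₀ * ε v₀ y.1 / (∑ u, ε v₀ u)) :
    Ppoly ε υ =
      Polynomial.C (υ v₀ / (υ v₀ + η)) * Ppoly ε υ' -
      Polynomial.C (η / (υ v₀ + η) * (∑ u, ε v₀ u)) *
        Ppoly εred (fun x => υ x.1) := by
  obtain ⟨B, hB⟩ := Ppoly_eq_add_of_eq_off ε υ v₀
  have hpos : υ v₀ + η ≠ 0 := (add_pos (hυ v₀) hη).ne'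
  have hmul : C (υ v₀ / (υ v₀ + η)) * C (υ v₀ + η) = C (υ v₀) := by
    rw [← C_mul, div_mul_cancel₀ _ hpos]
  have hadd : C (υ v₀ / (υ v₀ + η)) + C (η / (υ v₀ + η)) = 1 := by
    rw [← C_add, ← add_div, div_self hpos, C_1]
  have hzero := Ppoly_update_zero ε hdiag υ v₀ hv₀.ne'
  rw [← hred] at hzero
  rw [hB υ fun _ _ => rfl, hB υ' hυ'eq, hυ'v, hzero, C_mul]
  linear_combination (-X * B) * hmul + (C (∑ u, ε v₀ u) * Ppoly εred (fun x => υ x.1)) * hadd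
end

section
/- Let ε be an edge-weight function and υ a vertex-weight function on a finite set V with |V| ≥ 2, and let f : V → ℝ be a nonzero function with ∑_{v ∈ V} f(v)·υ(v) = 0. Then there exists t ∈ ℝ such that the sublevel set S_t = {v ∈ V : f(v) ≤ t} satisfies ∅ ⊊ S_t ⊊ V and θ(S_t)² / 2 ≤ (Q_ε(f) / ⟨f,f⟩_υ) · max_{v ∈ V} (d_ε(v)/υ(v)). -/
open Matrix Polynomial
open scoped Classical

/-- A nonempty strict sublevel set of a function on a finite type is a sublevel set. -/
theorem exists_lt_iff_le {V : Type*} [Fintype V] {f : V → ℝ} {c : ℝ} (h : ∃ v, f v < c) :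
    ∃ w, f w < c ∧ ∀ v, f v < c ↔ f v ≤ f w := by
  obtain ⟨v, hv⟩ := h
  obtain ⟨w, hw, hmax⟩ := Finset.exists_max_image (Finset.univ.filter (fun v => f v < c)) f
    ⟨v, by simpa using hv⟩
  have hw' : f w < c := by simpa using hw
  exact ⟨w, hw', fun v => ⟨fun hv => hmax v (by simpa using hv), fun hv => hv.trans_lt hw'⟩⟩

/-- Existence of a weighted median. -/
theorem exists_weighted_median {V : Type*} [Fintype V] [Nonempty V] (υ f : V → ℝ) (hυ : ∀ v, 0 ≤ υ v) :
    ∃ c, ∑ v with c < f v, υ v ≤ ∑ v with f v ≤ c, υ v ∧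
      ∑ v with f v < c, υ v ≤ ∑ v with c ≤ f v, υ v := by
  obtain ⟨m, hm⟩ := Finite.exists_max f
  obtain ⟨w, hw, hmin⟩ := Finset.exists_min_image
    (Finset.univ.filter (fun w => ∑ v with f w < f v, υ v ≤ ∑ v with f v ≤ f w, υ v)) f
    ⟨m, by
      rw [Finset.mem_filter_univ, Finset.sum_eq_zero]
      · exact Finset.sum_nonneg fun v _ => hυ v
      · intro v hv
        exact absurd (hm v) (not_le.2 (by simpa using hv))⟩
  refine ⟨f w, by simpa using hw, ?_⟩
  by_cases hlt : ∃ v, f v < f w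
  · obtain ⟨x, hx, hxw⟩ := exists_lt_iff_le hlt
    by_contra! hcon
    refine (hmin x ?_).not_gt hx
    have hxw' : ∀ v, f w ≤ f v ↔ f x < f v := fun v => by
      rw [← not_lt, hxw, not_le]
    simp only [hxw, hxw'] at hcon
    simpa using hcon.le
  · push Not at hlt
    rw [Finset.sum_eq_zero]
    · exact Finset.sum_nonneg fun v _ => hυ v
    · intro v hv
      exact absurd (hlt v) (not_le.2 (by simpa using hv))

/-- Total weight of the edges leaving `S`. -/
noncomputable def cutWeight {V : Type*} [Fintype V] [DecidableEq V] (ε : V → V → ℝ)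
    (S : Finset V) : ℝ :=
  ∑ u ∈ S, ∑ v ∈ Sᶜ, ε u v

section Cuts

variable {V : Type*} [Fintype V] [DecidableEq V]

theorem cutWeight_eq_sum_ite (ε : V → V → ℝ) (S : Finset V) :
    cutWeight ε S = ∑ u, ∑ v, ε u v * (if u ∈ S ∧ v ∉ S then 1 else 0) := by
  unfold cutWeight
  rw [← Finset.sum_filter_add_sum_filter_not Finset.univ (· ∈ S)
    (fun u => ∑ v, ε u v * (if u ∈ S ∧ v ∉ S then 1 else 0))]
  rw [Finset.sum_eq_zero (s := Finset.univ.filter (· ∉ S)), add_zero]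
  · refine Finset.sum_congr (by simp) fun u hu => ?_
    have hu' : u ∈ S := by simpa using hu
    simp only [hu', true_and, mul_ite, mul_one, mul_zero, ← Finset.sum_filter]
    exact Finset.sum_congr (by ext; simp) fun _ _ => rfl
  · intro u hu
    have hu' : u ∉ S := by simpa using hu
    simp [hu']

theorem cutWeight_compl {ε : V → V → ℝ} (hsym : ∀ u v, ε u v = ε v u) (S : Finset V) :
    cutWeight ε Sᶜ = cutWeight ε S := by
  unfold cutWeight
  rw [compl_compl, Finset.sum_comm]
  exact Finset.sum_congr rfl fun u _ => Finset.sum_congr rfl fun v _ => hsym _ _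

theorem cutWeight_nonneg {ε : V → V → ℝ} (hnonneg : ∀ u v, 0 ≤ ε u v) (S : Finset V) :
    0 ≤ cutWeight ε S :=
  Finset.sum_nonneg fun _ _ => Finset.sum_nonneg fun _ _ => hnonneg _ _

/-- Discrete co-area inequality: an isoperimetric inequality on all superlevel sets of a
nonnegative `p` bounds its weighted sum by its total variation. -/
theorem mul_sum_le_sum_max_sub_of_superlevel (ε : V → V → ℝ) (υ : V → ℝ) (φ : ℝ) (p : V → ℝ)
    (hp : ∀ v, 0 ≤ p v)
    (h : ∀ w, 0 < p w → φ * ∑ v with p w ≤ p v, υ v ≤ cutWeight ε {v | p w ≤ p v}) :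
    φ * ∑ v, υ v * p v ≤ ∑ u, ∑ v, ε u v * max (p u - p v) 0 := by
  induction hn : (Finset.univ.filter (fun v => 0 < p v)).card using Nat.strong_induction_on
    generalizing p with
  | _ n ih =>
  rcases (Finset.univ.filter (fun v => 0 < p v)).eq_empty_or_nonempty with he | hne
  · have h0 : ∀ v, p v = 0 := by
      intro v
      have : v ∉ Finset.univ.filter (fun v => 0 < p v) := by simp [he]
      exact le_antisymm (by simpa using this) (hp v)
    simp [h0]
  · obtain ⟨w, hw, hmin⟩ := Finset.exists_min_image _ p hne
    have hw0 : 0 < p w := by simpa using hw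
    have hmin' : ∀ v, p v = 0 ∨ p w ≤ p v := by
      intro v
      rcases (hp v).eq_or_lt with h0 | h0
      · exact Or.inl h0.symm
      · exact Or.inr (hmin v (by simpa using h0))
    have key := ih (Finset.univ.filter (fun v => 0 < max (p v - p w) 0)).card (by
        rw [← hn]
        apply Finset.card_lt_card
        refine Finset.ssubset_iff_subset_ne.2 ⟨fun v hv => ?_, fun heq => ?_⟩
        · simp only [Finset.mem_filter_univ, lt_max_iff, lt_irrefl, or_false] at hv ⊢
          linarith
        · rw [← heq] at hw
          simp at hw)
      (fun v => max (p v - p w) 0) (fun v => le_max_right _ _) (by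
        intro x hx
        have hx' : p w < p x := by simpa using hx
        have hset : ∀ v, max (p x - p w) 0 ≤ max (p v - p w) 0 ↔ p x ≤ p v := by
          intro v
          rw [max_eq_left (by linarith), le_max_iff]
          constructor
          · rintro (h | h) <;> linarith
          · intro h; left; linarith
        simp only [hset]
        exact h x (hw0.trans hx')) rfl
    have hA := h w hw0
    rw [cutWeight_eq_sum_ite] at hA
    have e1 : ∑ v, υ v * p v
        = p w * ∑ v with p w ≤ p v, υ v + ∑ v, υ v * max (p v - p w) 0 := by
      rw [Finset.sum_filter, Finset.mul_sum, ← Finset.sum_add_distrib]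
      refine Finset.sum_congr rfl fun v _ => ?_
      rcases hmin' v with h0 | h0
      · rw [if_neg (by linarith), max_eq_right (by linarith), h0]; ring
      · rw [if_pos h0, max_eq_left (by linarith)]; ring
    have e2 : ∑ u, ∑ v, ε u v * max (p u - p v) 0
        = p w * ∑ u, ∑ v, ε u v * (if u ∈ Finset.univ.filter (fun v => p w ≤ p v) ∧
            v ∉ Finset.univ.filter (fun v => p w ≤ p v) then 1 else 0)
          + ∑ u, ∑ v, ε u v * max (max (p u - p w) 0 - max (p v - p w) 0) 0 := by
      simp only [Finset.mul_sum, ← Finset.sum_add_distrib]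
      refine Finset.sum_congr rfl fun u _ => Finset.sum_congr rfl fun v _ => ?_
      simp only [Finset.mem_filter_univ]
      rcases hmin' u with hu | hu <;> rcases hmin' v with hv | hv
      · simp [hu, hv]
      · rw [if_neg (by rintro ⟨h1, h2⟩; exact h2 hv), hu, max_eq_right (by linarith),
          max_eq_right (a := 0 - p w) (by linarith), max_eq_left (a := p v - p w) (by linarith),
          max_eq_right (by linarith)]
        ring
      · rw [if_pos ⟨hu, by linarith⟩, hv, max_eq_left (by linarith),
          max_eq_right (a := 0 - p w) (by linarith), max_eq_left (a := p u - p w) (by linarith),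
          max_eq_left (by linarith)]
        ring
      · rw [if_neg (by rintro ⟨h1, h2⟩; exact h2 hv),
          max_eq_left (a := p v - p w) (by linarith), max_eq_left (a := p u - p w) (by linarith),
          sub_sub_sub_cancel_right]
        ring
    rw [e1, e2, mul_add]
    have := mul_le_mul_of_nonneg_left hA hw0.le
    linarith

/-- Cheeger's inequality around a weighted median `c`, with the isoperimetric inequality
assumed for all proper sublevel sets. -/
theorem sq_mul_sum_le_of_sublevel {ε : V → V → ℝ} (hsym : ∀ u v, ε u v = ε v u)
    (hnonneg : ∀ u v, 0 ≤ ε u v) {υ : V → ℝ} (hυ : ∀ v, 0 ≤ υ v) {f : V → ℝ} {φ M c : ℝ}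
    (hφ : 0 ≤ φ) (hM : ∀ v, ∑ u, ε v u ≤ M * υ v)
    (hc₁ : ∑ v with c < f v, υ v ≤ ∑ v with f v ≤ c, υ v)
    (hc₂ : ∑ v with f v < c, υ v ≤ ∑ v with c ≤ f v, υ v)
    (hcut : ∀ w, (∃ v, f w < f v) →
      φ * min (∑ v with f v ≤ f w, υ v) (∑ v with f w < f v, υ v)
        ≤ cutWeight ε {v | f v ≤ f w})
    (hG : 0 < ∑ v, υ v * (f v - c) ^ 2) :
    φ ^ 2 * ∑ v, υ v * (f v - c) ^ 2 ≤ M * ∑ u, ∑ v, ε u v * (f u - f v) ^ 2 := by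
  have hmono : ∀ {P Q : V → Prop} [DecidablePred P] [DecidablePred Q], (∀ v, P v → Q v) →
      ∑ v with P v, υ v ≤ ∑ v with Q v, υ v := by
    intro P Q _ _ hPQ
    exact Finset.sum_le_sum_of_subset_of_nonneg
      (Finset.monotone_filter_right _ fun v _ hv => hPQ v hv) fun v _ _ => hυ v
  have hneg := mul_sum_le_sum_max_sub_of_superlevel ε υ φ (fun v => (max (c - f v) 0) ^ 2)
    (fun v => sq_nonneg _) (by
      intro w hw
      have hwc : f w < c := by
        by_contra! hcw
        simp [max_eq_right (sub_nonpos.2 hcw)] at hw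
      have hset : ∀ v, (max (c - f w) 0) ^ 2 ≤ (max (c - f v) 0) ^ 2 ↔ f v ≤ f w := by
        intro v
        rw [sq_le_sq₀ (le_max_right _ _) (le_max_right _ _), max_eq_left (by linarith), le_max_iff]
        constructor
        · rintro (h | h) <;> linarith
        · intro h; left; linarith
      simp only [hset]
      by_cases hex : ∃ v, f w < f v
      · refine le_trans (mul_le_mul_of_nonneg_left (le_min le_rfl ?_) hφ) (hcut w hex)
        calc _ ≤ ∑ v with f v < c, υ v := hmono fun v hv => hv.trans_lt hwc
          _ ≤ _ := hc₂
          _ ≤ _ := hmono fun v hv => hwc.trans_le hv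
      · push Not at hex
        have h1 : ∑ v with f v ≤ f w, υ v ≤ 0 := by
          calc _ ≤ ∑ v with f v < c, υ v := hmono fun v hv => hv.trans_lt hwc
            _ ≤ _ := hc₂
            _ = 0 := Finset.sum_eq_zero fun v hv => by
              have : c ≤ f v := by simpa using hv
              linarith [hex v]
        exact (mul_nonpos_of_nonneg_of_nonpos hφ h1).trans (cutWeight_nonneg hnonneg _))
  have hpos := mul_sum_le_sum_max_sub_of_superlevel ε υ φ (fun v => (max (f v - c) 0) ^ 2)
    (fun v => sq_nonneg _) (by
      intro w hw
      have hwc : c < f w := by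
        by_contra! hcw
        simp [max_eq_right (sub_nonpos.2 hcw)] at hw
      have hset : ∀ v, (max (f w - c) 0) ^ 2 ≤ (max (f v - c) 0) ^ 2 ↔ f w ≤ f v := by
        intro v
        rw [sq_le_sq₀ (le_max_right _ _) (le_max_right _ _), max_eq_left (by linarith), le_max_iff]
        constructor
        · rintro (h | h) <;> linarith
        · intro h; left; linarith
      simp only [hset]
      by_cases hex : ∃ v, f v < f w
      · obtain ⟨x, hx, hxw⟩ := exists_lt_iff_le hex
        have hxw' : ∀ v, f w ≤ f v ↔ f x < f v := fun v => by
          rw [← not_lt, hxw, not_le]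
        simp only [hxw']
        have hcompl : Finset.univ.filter (fun v => f x < f v)
            = (Finset.univ.filter (fun v => f v ≤ f x))ᶜ := by
          ext v; simp
        rw [hcompl, cutWeight_compl hsym, ← hcompl]
        refine le_trans (mul_le_mul_of_nonneg_left (le_min ?_ le_rfl) hφ) (hcut x ⟨w, hx⟩)
        calc _ ≤ ∑ v with c < f v, υ v := hmono fun v hv => hwc.trans_le ((hxw' v).2 hv)
          _ ≤ _ := hc₁
          _ ≤ _ := hmono fun v hv => (hxw v).1 (lt_of_le_of_lt hv hwc)
      · push Not at hex
        have h1 : ∑ v with f w ≤ f v, υ v ≤ 0 := by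
          calc _ ≤ ∑ v with c < f v, υ v := hmono fun v hv => hwc.trans_le hv
            _ ≤ _ := hc₁
            _ = 0 := Finset.sum_eq_zero fun v hv => by
              have : f v ≤ c := by simpa using hv
              linarith [hex v]
        exact (mul_nonpos_of_nonneg_of_nonpos hφ h1).trans (cutWeight_nonneg hnonneg _))
  set G := ∑ v, υ v * (f v - c) ^ 2 with hGdef
  set R := ∑ u, ∑ v, ε u v * (f u - f v) ^ 2 with hRdef
  set X := ∑ u, ∑ v, ε u v * (|f u - f v| * (|f u - c| + |f v - c|)) with hXdef
  set Y := ∑ u, ∑ v, ε u v * (|f u - c| + |f v - c|) ^ 2 with hYdef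
  have hswap : ∀ F : V → V → ℝ,
      ∑ u, ∑ v, ε u v * F u v = ∑ u, ∑ v, ε u v * F v u := by
    intro F
    rw [Finset.sum_comm]
    exact Finset.sum_congr rfl fun u _ => Finset.sum_congr rfl fun v _ => by rw [hsym]
  have hGsum : G = ∑ v, υ v * (max (f v - c) 0) ^ 2 + ∑ v, υ v * (max (c - f v) 0) ^ 2 := by
    rw [hGdef, ← Finset.sum_add_distrib]
    refine Finset.sum_congr rfl fun v _ => ?_
    rcases le_total (f v) c with h | h
    · rw [max_eq_right (by linarith), max_eq_left (by linarith)]; ring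
    · rw [max_eq_left (by linarith), max_eq_right (by linarith)]; ring
  have hTV : 2 * (φ * G) ≤ X := by
    have hpos' := hswap fun u v => max ((max (f u - c) 0) ^ 2 - (max (f v - c) 0) ^ 2) 0
    have hneg' := hswap fun u v => max ((max (c - f u) 0) ^ 2 - (max (c - f v) 0) ^ 2) 0
    refine le_trans (b := ∑ u, ∑ v, ε u v *
      (max ((max (f u - c) 0) ^ 2 - (max (f v - c) 0) ^ 2) 0
      + max ((max (f v - c) 0) ^ 2 - (max (f u - c) 0) ^ 2) 0
      + max ((max (c - f u) 0) ^ 2 - (max (c - f v) 0) ^ 2) 0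
      + max ((max (c - f v) 0) ^ 2 - (max (c - f u) 0) ^ 2) 0)) ?_ ?_
    · simp only [mul_add, Finset.sum_add_distrib]
      rw [hGsum]
      linarith
    · refine Finset.sum_le_sum fun u _ => Finset.sum_le_sum fun v _ =>
        mul_le_mul_of_nonneg_left ?_ (hnonneg u v)
      have hdiff : f u - f v = (f u - c) - (f v - c) := by ring
      have e : ∀ x : V, c - f x = -(f x - c) := fun x => by ring
      rw [hdiff, e u, e v]
      generalize f u - c = a
      generalize f v - c = b
      have hmax : ∀ x : ℝ, max x 0 + max (-x) 0 = |x| := fun x => by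
        rcases le_total x 0 with h | h
        · rw [max_eq_right h, max_eq_left (by linarith), abs_of_nonpos h]; ring
        · rw [max_eq_left h, max_eq_right (by linarith), abs_of_nonneg h]; ring
      rw [← neg_sub ((max a 0) ^ 2), ← neg_sub ((max (-a) 0) ^ 2), hmax, add_assoc, hmax]
      rcases le_total a 0 with ha | ha <;> rcases le_total b 0 with hb | hb
      · rw [max_eq_right ha, max_eq_right hb, max_eq_left (a := -a) (by linarith),
          max_eq_left (a := -b) (by linarith), abs_of_nonpos ha, abs_of_nonpos hb]
        have : (-a) ^ 2 - (-b) ^ 2 = (a - b) * (a + b) := by ring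
        rw [this, abs_mul, abs_of_nonpos (a := a + b) (by linarith)]
        simp only [sub_self, abs_zero, zero_add]
        apply le_of_eq; ring
      · rw [max_eq_right ha, max_eq_left hb, max_eq_left (a := -a) (by linarith),
          max_eq_right (a := -b) (by linarith), abs_of_nonpos ha, abs_of_nonneg hb,
          abs_of_nonpos (a := a - b) (by linarith), abs_of_nonpos (by nlinarith),
          abs_of_nonneg (by nlinarith)]
        nlinarith
      · rw [max_eq_left ha, max_eq_right hb, max_eq_right (a := -a) (by linarith),
          max_eq_left (a := -b) (by linarith), abs_of_nonneg ha, abs_of_nonpos hb,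
          abs_of_nonneg (a := a - b) (by linarith), abs_of_nonneg (by nlinarith),
          abs_of_nonpos (by nlinarith)]
        nlinarith
      · rw [max_eq_left ha, max_eq_left hb, max_eq_right (a := -a) (by linarith),
          max_eq_right (a := -b) (by linarith), abs_of_nonneg ha, abs_of_nonneg hb]
        have : a ^ 2 - b ^ 2 = (a - b) * (a + b) := by ring
        rw [this, abs_mul, abs_of_nonneg (a := a + b) (by linarith)]
        simp
  have hCS : X ^ 2 ≤ R * Y := by
    simp only [hXdef, hRdef, hYdef, ← Fintype.sum_prod_type']
    apply Finset.sum_sq_le_sum_mul_sum_of_sq_le_mul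
    · exact fun x _ => mul_nonneg (hnonneg _ _) (sq_nonneg _)
    · exact fun x _ => mul_nonneg (hnonneg _ _) (sq_nonneg _)
    · intro x _
      refine le_of_eq ?_
      rw [mul_pow, mul_pow, sq_abs]
      ring
  have hR : 0 ≤ R := Finset.sum_nonneg fun _ _ => Finset.sum_nonneg fun _ _ =>
    mul_nonneg (hnonneg _ _) (sq_nonneg _)
  have hY : Y ≤ 4 * (M * G) := by
    have hdeg : ∑ u, ∑ v, ε u v * (f u - c) ^ 2 ≤ M * G := by
      rw [hGdef, Finset.mul_sum]
      refine Finset.sum_le_sum fun u _ => ?_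
      rw [← Finset.sum_mul, ← mul_assoc]
      exact mul_le_mul_of_nonneg_right (hM u) (sq_nonneg _)
    have hdeg' := hswap fun u _ => (f u - c) ^ 2
    calc Y ≤ ∑ u, ∑ v, (2 * (ε u v * (f u - c) ^ 2) + 2 * (ε u v * (f v - c) ^ 2)) := by
          refine Finset.sum_le_sum fun u _ => Finset.sum_le_sum fun v _ => ?_
          have := mul_le_mul_of_nonneg_left (add_sq_le (a := |f u - c|) (b := |f v - c|))
            (hnonneg u v)
          rw [sq_abs, sq_abs] at this
          linarith
      _ ≤ 4 * (M * G) := by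
          simp only [Finset.sum_add_distrib, ← Finset.mul_sum]
          linarith
  have h1 : (2 * (φ * G)) ^ 2 ≤ X ^ 2 :=
    pow_le_pow_left₀ (by positivity) hTV 2
  have h2 : R * Y ≤ R * (4 * (M * G)) := mul_le_mul_of_nonneg_left hY hR
  refine le_of_mul_le_mul_right ?_ hG
  nlinarith

end Cuts

/-- **Sparse cuts from scalar fields with small Rayleigh quotient**: for nonzero `f`
orthogonal to the constants, some sublevel set `S_t` is a nonempty proper subset with
`θ(S_t)² / 2 ≤ (Q_ε(f)/⟨f,f⟩_υ) · max_v d_ε(v)/υ(v)`. -/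
theorem sparse_cut_from_rayleigh
    {V : Type} [Fintype V] [DecidableEq V]
    (ε : V → V → ℝ) (hsym : ∀ u v, ε u v = ε v u)
    (hnonneg : ∀ u v, 0 ≤ ε u v) (hdiag : ∀ v, ε v v = 0)
    (υ : V → ℝ) (hυ : ∀ v, 0 < υ v)
    (hcard : 2 ≤ Fintype.card V)
    (f : V → ℝ) (hf : f ≠ 0) (horth : ∑ v, f v * υ v = 0)
    (M : ℝ) (hM : IsGreatest (Set.range fun v => (∑ u, ε v u) / υ v) M) :
    ∃ t : ℝ,
      (Finset.univ.filter (fun v => f v ≤ t)).Nonempty ∧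
      Finset.univ.filter (fun v => f v ≤ t) ≠ Finset.univ ∧
      ((∑ u ∈ Finset.univ.filter (fun v => f v ≤ t),
          ∑ v ∈ (Finset.univ.filter (fun v => f v ≤ t))ᶜ, ε u v) /
        min (∑ v ∈ Finset.univ.filter (fun v => f v ≤ t), υ v)
          (∑ v ∈ (Finset.univ.filter (fun v => f v ≤ t))ᶜ, υ v)) ^ 2 / 2 ≤
      ((1 / 2 : ℝ) * ∑ u, ∑ v, ε u v * (f u - f v) ^ 2) /
        (∑ v, υ v * f v ^ 2) * M := by
  have : Nonempty V := Fintype.card_pos_iff.1 (by lia)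
  have hF : 0 < ∑ v, υ v * f v ^ 2 := by
    obtain ⟨x, hx⟩ := Function.ne_iff.1 hf
    exact Finset.sum_pos' (fun v _ => mul_nonneg (hυ v).le (sq_nonneg _))
      ⟨x, Finset.mem_univ _, mul_pos (hυ x) (sq_pos_of_ne_zero hx)⟩
  obtain ⟨c, hc₁, hc₂⟩ := exists_weighted_median υ f fun v => (hυ v).le
  have hFG : ∑ v, υ v * f v ^ 2 ≤ ∑ v, υ v * (f v - c) ^ 2 := by
    have e : ∑ v, υ v * (f v - c) ^ 2
        = ∑ v, υ v * f v ^ 2 - 2 * c * ∑ v, f v * υ v + ∑ v, υ v * c ^ 2 := by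
      rw [Finset.mul_sum, ← Finset.sum_sub_distrib, ← Finset.sum_add_distrib]
      exact Finset.sum_congr rfl fun v _ => by ring
    rw [e, horth]
    have : 0 ≤ ∑ v, υ v * c ^ 2 :=
      Finset.sum_nonneg fun v _ => mul_nonneg (hυ v).le (sq_nonneg _)
    linarith
  have hproper : (Finset.univ.filter (fun w => ∃ v, f w < f v)).Nonempty := by
    by_contra hempty
    have hle : ∀ w v, f v ≤ f w := by
      intro w v
      by_contra! hlt
      exact hempty ⟨w, by simpa using ⟨v, hlt⟩⟩
    apply hf
    funext x
    have hconst : f x * ∑ v, υ v = 0 := by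
      rw [← horth, Finset.mul_sum]
      exact Finset.sum_congr rfl fun v _ => by rw [le_antisymm (hle x v) (hle v x)]
    have hpos : 0 < ∑ v, υ v := Finset.sum_pos (fun v _ => hυ v) Finset.univ_nonempty
    exact (mul_eq_zero.1 hconst).resolve_right hpos.ne'
  have hcompl : ∀ w, (Finset.univ.filter (fun v => f v ≤ f w))ᶜ
      = Finset.univ.filter (fun v => f w < f v) := by
    intro w; ext v; simp
  obtain ⟨w, hw, hmin⟩ := Finset.exists_min_image _
    (fun w => cutWeight ε (Finset.univ.filter (fun v => f v ≤ f w)) /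
      min (∑ v with f v ≤ f w, υ v) (∑ v with f w < f v, υ v)) hproper
  obtain ⟨x, hx⟩ : ∃ v, f w < f v := by simpa using hw
  have hminpos : ∀ w, (∃ v, f w < f v) →
      0 < min (∑ v with f v ≤ f w, υ v) (∑ v with f w < f v, υ v) := by
    rintro w ⟨x, hx⟩
    exact lt_min (Finset.sum_pos (fun v _ => hυ v) ⟨w, by simp⟩)
      (Finset.sum_pos (fun v _ => hυ v) ⟨x, by simpa using hx⟩)
  refine ⟨f w, ⟨w, by simp⟩, fun huniv => ?_, ?_⟩
  · have : x ∈ Finset.univ.filter (fun v => f v ≤ f w) := by rw [huniv]; simp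
    exact absurd hx (not_lt.2 (by simpa using this))
  · have hdeg : ∀ v, ∑ u, ε v u ≤ M * υ v := fun v =>
      (div_le_iff₀ (hυ v)).1 (hM.2 ⟨v, rfl⟩)
    have hcheeger := sq_mul_sum_le_of_sublevel hsym hnonneg (fun v => (hυ v).le)
      (div_nonneg (cutWeight_nonneg hnonneg _) (hminpos w ⟨x, hx⟩).le) hdeg hc₁ hc₂
      (fun y hy => (le_div_iff₀ (hminpos y hy)).1 (hmin y (by simpa using hy)))
      (hF.trans_le hFG)
    have hmul := (mul_le_mul_of_nonneg_left hFG (sq_nonneg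
      (cutWeight ε (Finset.univ.filter (fun v => f v ≤ f w)) /
        min (∑ v with f v ≤ f w, υ v) (∑ v with f w < f v, υ v)))).trans hcheeger
    rw [div_mul_eq_mul_div, le_div_iff₀ hF]
    simp only [cutWeight, hcompl] at hmul ⊢
    linarith
end

section
/- Let ε be an edge-weight function and υ a vertex-weight function on a finite set V with n = |V|, suppose there exist distinct u,v ∈ V with ε(u,v) > 0, and let λ_n be the largest weighted Laplacian eigenvalue of (ε,υ). Let S ⊆ V be a nonempty independent set, i.e. ε(u,v) = 0 for all u,v ∈ S. Then λ_n > 0 and υ(S) ≤ υ(V) · (λ_n − d_ε(S)/υ(S)) / λ_n, where d_ε(S) = ∑_{v ∈ S} d_ε(v). -/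
open Matrix Polynomial
open scoped Classical

/-- A bound on the eigenvalues of `diagonal υ⁻¹ * L`, for `L` symmetric and `υ` positive, bounds the
quadratic form of `L` by the weighted sum of squares. -/
theorem Matrix.dotProduct_mulVec_le_of_charpoly_roots_le {V : Type*} [Fintype V] [DecidableEq V]
    {L : Matrix V V ℝ} (hL : ∀ u v, L u v = L v u) {υ : V → ℝ} (hυ : ∀ v, 0 < υ v) {b : ℝ}
    (hb : ∀ ν : ℝ, (diagonal (fun v => (υ v)⁻¹) * L).charpoly.IsRoot ν → ν ≤ b) (x : V → ℝ) :
    x ⬝ᵥ L *ᵥ x ≤ b * ∑ v, υ v * x v ^ 2 := by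
  have hs : ∀ v, √(υ v) ≠ 0 := fun v => (Real.sqrt_pos.2 (hυ v)).ne'
  have hss : ∀ v, √(υ v) * √(υ v) = υ v := fun v => Real.mul_self_sqrt (hυ v).le
  let A : Matrix V V ℝ := of fun u v => L u v / (√(υ u) * √(υ v))
  have hM : (b • (1 : Matrix V V ℝ) - A).IsHermitian := by
    ext u v
    simp only [A, conjTranspose_apply, sub_apply, smul_apply, of_apply, star_trivial, one_apply,
      hL v u, mul_comm (√(υ v)), eq_comm (a := v)]
  have hpsd : (b • (1 : Matrix V V ℝ) - A).PosSemidef := by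
    rw [hM.posSemidef_iff_eigenvalues_nonneg]
    intro j
    have hev := hM.mulVec_eigenvectorBasis j
    have hne : (hM.eigenvectorBasis j).ofLp ≠ 0 := by
      intro h
      exact hM.eigenvectorBasis.orthonormal.ne_zero j (by ext v; simpa using congrFun h v)
    generalize (hM.eigenvectorBasis j).ofLp = z at hev hne
    generalize hM.eigenvalues j = μ at hev ⊢
    have hroot : (diagonal (fun v => (υ v)⁻¹) * L).charpoly.IsRoot (b - μ) := by
      rw [IsRoot.def, eval_charpoly, ← exists_mulVec_eq_zero_iff]
      refine ⟨fun v => z v / √(υ v), ?_, ?_⟩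
      · intro h
        refine hne (funext fun v => ?_)
        simpa [hs v] using congrFun h v
      · ext u
        have hu := congrFun hev u
        simp only [sub_mulVec, smul_mulVec, one_mulVec, Pi.sub_apply, Pi.smul_apply,
          smul_eq_mul] at hu
        have hA : (A *ᵥ z) u = (∑ v, L u v * (z v / √(υ v))) / √(υ u) := by
          simp only [A, mulVec, dotProduct, of_apply, Finset.sum_div]
          refine Finset.sum_congr rfl fun v _ => ?_
          have := hs u
          have := hs v
          field_simp
        have hdl : ((diagonal (fun v => (υ v)⁻¹) * L) *ᵥ fun v => z v / √(υ v)) u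
            = (υ u)⁻¹ * ∑ v, L u v * (z v / √(υ v)) := by
          rw [← mulVec_mulVec, mulVec_diagonal]
          rfl
        rw [hA] at hu
        rw [sub_mulVec, Pi.sub_apply, hdl, scalar_apply, mulVec_diagonal, Pi.zero_apply,
          show (υ u)⁻¹ = (√(υ u))⁻¹ * (√(υ u))⁻¹ by rw [← mul_inv, hss]]
        have h' : (b - μ) * z u = (∑ v, L u v * (z v / √(υ v))) / √(υ u) := by linarith
        rw [← mul_div_assoc, h']
        ring
    change 0 ≤ μ
    linarith [hb _ hroot]
  have hy := hpsd.dotProduct_mulVec_nonneg (fun v => √(υ v) * x v)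
  rw [sub_mulVec, smul_mulVec, one_mulVec, dotProduct_sub, dotProduct_smul, star_trivial,
    smul_eq_mul] at hy
  have h1 : (fun v => √(υ v) * x v) ⬝ᵥ (fun v => √(υ v) * x v) = ∑ v, υ v * x v ^ 2 := by
    refine Finset.sum_congr rfl fun v _ => ?_
    rw [← hss v]
    ring
  have h2 : (fun v => √(υ v) * x v) ⬝ᵥ A *ᵥ (fun v => √(υ v) * x v) = x ⬝ᵥ L *ᵥ x := by
    simp only [A, mulVec, dotProduct, of_apply, Finset.mul_sum]
    refine Finset.sum_congr rfl fun u _ => Finset.sum_congr rfl fun v _ => ?_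
    have := hs u
    have := hs v
    field_simp
  rw [h1, h2] at hy
  linarith

theorem lapMat_mulVec {V : Type} [Fintype V] [DecidableEq V] (ε : V → V → ℝ) (x : V → ℝ) (v : V) :
    (lapMat ε *ᵥ x) v = ∑ u, ε v u * (x v - x u) := by
  rw [lapMat, sub_mulVec, Pi.sub_apply, mulVec_diagonal, Finset.sum_mul]
  simp only [mulVec, dotProduct, of_apply, ← Finset.sum_sub_distrib, mul_sub]

/-- The Laplacian form at a shifted indicator of an independent set is the degree of the set. -/
theorem dotProduct_lapMat_mulVec_indicator_sub {V : Type} [Fintype V] [DecidableEq V]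
    {ε : V → V → ℝ} (hsym : ∀ u v, ε u v = ε v u) {S : Finset V}
    (hind : ∀ u ∈ S, ∀ v ∈ S, ε u v = 0) (c : ℝ) :
    (fun v => (if v ∈ S then 1 else 0) - c) ⬝ᵥ
      lapMat ε *ᵥ (fun v => (if v ∈ S then 1 else 0) - c) = ∑ v ∈ S, ∑ u, ε v u := by
  set e : V → ℝ := fun v => if v ∈ S then 1 else 0 with he
  have hzero : ∑ v, ∑ u, ε v u * (e v - e u) = 0 := by
    have h : ∑ v, ∑ u, ε v u * (e v - e u) = ∑ v, ∑ u, -(ε v u * (e v - e u)) := by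
      rw [Finset.sum_comm]
      refine Finset.sum_congr rfl fun u _ => Finset.sum_congr rfl fun v _ => ?_
      rw [hsym]
      ring
    simp only [Finset.sum_neg_distrib] at h
    linarith
  have hS : ∑ v, e v * ∑ u, ε v u * (e v - e u) = ∑ v ∈ S, ∑ u, ε v u := by
    simp only [he, ite_mul, one_mul, zero_mul, Finset.sum_ite_mem, Finset.univ_inter]
    refine Finset.sum_congr rfl fun v hv => Finset.sum_congr rfl fun u _ => ?_
    by_cases hu : u ∈ S
    · simp [hind v hv u hu]
    · simp [hv, hu]
  simp only [dotProduct, lapMat_mulVec, sub_sub_sub_cancel_right, sub_mul, Finset.sum_sub_distrib,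
    ← Finset.mul_sum]
  change ∑ v, e v * ∑ u, ε v u * (e v - e u) - c * ∑ v, ∑ u, ε v u * (e v - e u) = _
  rw [hzero, hS, mul_zero, sub_zero]

/-- **Weighted independent set bound**: for a nonempty independent set `S`,
`υ(S) ≤ υ(V) (λₙ - d_ε(S)/υ(S))/λₙ`, where `λₙ` is the largest weighted Laplacian
eigenvalue. -/
theorem weighted_independent_set_bound
    {V : Type} [Fintype V] [DecidableEq V]
    (ε : V → V → ℝ) (hsym : ∀ u v, ε u v = ε v u)
    (hnonneg : ∀ u v, 0 ≤ ε u v) (hdiag : ∀ v, ε v v = 0)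
    (υ : V → ℝ) (hυ : ∀ v, 0 < υ v)
    (n : ℕ) (hn : n = Fintype.card V)
    (hedge : ∃ u v : V, u ≠ v ∧ 0 < ε u v)
    (lam : Fin n → ℝ) (hlamMono : Monotone lam)
    (hlam : (wlap ε υ).charpoly = ∏ i, (X - C (lam i)))
    (S : Finset V) (hSne : S.Nonempty)
    (hind : ∀ u ∈ S, ∀ v ∈ S, ε u v = 0) :
    ∀ i : Fin n, (i : ℕ) + 1 = n →
      0 < lam i ∧
      ∑ v ∈ S, υ v ≤ (∑ v, υ v) *
        (lam i - (∑ v ∈ S, ∑ u, ε v u) / (∑ v ∈ S, υ v)) / lam i := by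
  intro i hi
  have hroots : ∀ ν : ℝ, (wlap ε υ).charpoly.IsRoot ν → ν ≤ lam i := by
    intro ν hν
    rw [hlam, IsRoot.def, eval_prod, Finset.prod_eq_zero_iff] at hν
    obtain ⟨j, -, hj⟩ := hν
    rw [eval_sub, eval_X, eval_C, sub_eq_zero] at hj
    rw [hj]
    exact hlamMono (Fin.le_def.2 (by omega))
  have hL : ∀ u v, lapMat ε u v = lapMat ε v u := by
    intro u v
    by_cases h : u = v
    · rw [h]
    · simp [lapMat, h, Ne.symm h, hsym u v]
  have key := dotProduct_mulVec_le_of_charpoly_roots_le hL hυ hroots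
  have hpos : 0 < lam i := by
    obtain ⟨u, v, -, huv⟩ := hedge
    have hu := key (fun w => (if w ∈ ({u} : Finset V) then 1 else 0) - 0)
    rw [dotProduct_lapMat_mulVec_indicator_sub hsym (by simp [hdiag])] at hu
    simp only [Finset.sum_singleton, Finset.mem_singleton, sub_zero, ite_pow, one_pow,
      ne_eq, OfNat.ofNat_ne_zero, not_false_eq_true, zero_pow, mul_ite, mul_one, mul_zero,
      Finset.sum_ite_eq', Finset.mem_univ, if_true] at hu
    have hd : ε u v ≤ ∑ w, ε u w :=
      Finset.single_le_sum (fun w _ => hnonneg u w) (Finset.mem_univ v)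
    exact pos_of_mul_pos_left (by linarith) (hυ u).le
  refine ⟨hpos, ?_⟩
  have hs : 0 < ∑ v ∈ S, υ v := Finset.sum_pos (fun v _ => hυ v) hSne
  have hT : 0 < ∑ v, υ v := Finset.sum_pos (fun v _ => hυ v) ⟨_, Finset.mem_univ hSne.choose⟩
  have hd := key (fun v => (if v ∈ S then 1 else 0) - (∑ v ∈ S, υ v) / ∑ v, υ v)
  rw [dotProduct_lapMat_mulVec_indicator_sub hsym hind] at hd
  have hsq : ∀ c : ℝ, ∑ v, υ v * ((if v ∈ S then 1 else 0) - c) ^ 2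
      = (1 - 2 * c) * (∑ v ∈ S, υ v) + c ^ 2 * ∑ v, υ v := by
    intro c
    rw [← Finset.univ_inter S, ← Finset.sum_ite_mem, Finset.mul_sum, Finset.mul_sum,
      ← Finset.sum_add_distrib]
    refine Finset.sum_congr rfl fun v _ => ?_
    simp only [Finset.univ_inter]
    split_ifs <;> ring
  rw [hsq] at hd
  generalize (∑ v ∈ S, ∑ u, ε v u) = d at hd ⊢
  generalize (∑ v ∈ S, υ v) = s at hd hs ⊢
  generalize (∑ v, υ v) = T at hd hT ⊢
  have hq : (1 - 2 * (s / T)) * s + (s / T) ^ 2 * T = s * (T - s) / T := by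
    field_simp
    ring
  rw [hq, ← mul_div_assoc, le_div_iff₀ hT] at hd
  rw [le_div_iff₀ hpos, ← mul_le_mul_iff_left₀ hs]
  have hr : T * (lam i - d / s) * s = T * lam i * s - d * T := by
    field_simp
  rw [hr]
  linarith
end

section
/- Let ε be an edge-weight function and υ a vertex-weight function on a finite set V with n = |V|, suppose there exist distinct u,v ∈ V with ε(u,v) > 0, and let λ_n be the largest weighted Laplacian eigenvalue of (ε,υ). Let m = ∑_{u,v ∈ V} ε(u,v) (twice the total edge weight) and let χ be the chromatic number of G(ε). Then λ_n > m/υ(V) and χ ≥ λ_n / (λ_n − m/υ(V)); equivalently, m·χ ≤ υ(V)·λ_n·(χ − 1). -/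
open Matrix Polynomial
open scoped Classical

/-- The quadratic form of the Laplacian, relative to the vertex weights, is at most any bound on the
roots of the characteristic polynomial of the weighted Laplacian. -/
theorem wlap_quadratic_form_le {V : Type} [Fintype V] [DecidableEq V]
    {ε : V → V → ℝ} (hsym : ∀ u v, ε u v = ε v u) {υ : V → ℝ} (hυ : ∀ v, 0 < υ v)
    {l : ℝ} (hl : ∀ x, (wlap ε υ).charpoly.IsRoot x → x ≤ l) (y : V → ℝ) :
    y ⬝ᵥ (lapMat ε *ᵥ y) ≤ l * ∑ v, υ v * y v ^ 2 := by
  set D : Matrix V V ℝ := Matrix.diagonal fun v => (√(υ v))⁻¹ with hD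
  have hs : ∀ v, √(υ v) ≠ 0 := fun v => (Real.sqrt_pos.2 (hυ v)).ne'
  have hL : (lapMat ε).IsHermitian := by
    ext u v
    by_cases h : u = v
    · subst h; simp [lapMat]
    · simp [lapMat, h, Ne.symm h, hsym u v]
  have hDh : D.IsHermitian := Matrix.isHermitian_diagonal _
  have hA : (D * lapMat ε * D).IsHermitian := by
    have := Matrix.isHermitian_conjTranspose_mul_mul D hL
    rwa [hDh.eq] at this
  have hchar : (D * lapMat ε * D).charpoly = (wlap ε υ).charpoly := by
    rw [Matrix.charpoly_mul_comm, ← mul_assoc, hD, Matrix.diagonal_mul_diagonal, wlap]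
    congr 3
    ext v
    rw [← mul_inv, Real.mul_self_sqrt (hυ v).le]
  have hpsd : (algebraMap ℝ (Matrix V V ℝ) l - D * lapMat ε * D).PosSemidef := by
    rw [Matrix.posSemidef_iff_isHermitian_and_spectrum_nonneg]
    refine ⟨Matrix.IsHermitian.sub ?_ hA, ?_⟩
    · rw [Matrix.algebraMap_eq_diagonal]
      exact Matrix.isHermitian_diagonal _
    · rw [← spectrum.singleton_sub_eq]
      rintro _ ⟨_, rfl, x, hx, rfl⟩
      have := hl x (hchar ▸ Matrix.mem_spectrum_iff_isRoot_charpoly.1 hx)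
      simpa using this
  have key := hpsd.dotProduct_mulVec_nonneg fun v => √(υ v) * y v
  have hDx : (D *ᵥ fun v => √(υ v) * y v) = y := by
    ext v
    rw [hD, Matrix.mulVec_diagonal, inv_mul_cancel_left₀ (hs v)]
  have hxD : (fun v => √(υ v) * y v) ᵥ* D = y := by
    ext v
    rw [hD, Matrix.vecMul_diagonal, mul_comm, inv_mul_cancel_left₀ (hs v)]
  have hnorm : (fun v => √(υ v) * y v) ⬝ᵥ (l • fun v => √(υ v) * y v)
      = l * ∑ v, υ v * y v ^ 2 := by
    rw [dotProduct_smul, smul_eq_mul, dotProduct]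
    congr 1
    refine Finset.sum_congr rfl fun v _ => ?_
    rw [mul_mul_mul_comm, Real.mul_self_sqrt (hυ v).le, sq]
  rw [star_trivial, Matrix.sub_mulVec, dotProduct_sub, ← Matrix.mulVec_mulVec, hDx,
    ← Matrix.mulVec_mulVec, Matrix.dotProduct_mulVec _ D, hxD, Algebra.algebraMap_eq_smul_one,
    Matrix.smul_mulVec, Matrix.one_mulVec, hnorm] at key
  linarith

theorem dotProduct_lapMat_mulVec {V : Type} [Fintype V] [DecidableEq V]
    (ε : V → V → ℝ) (y : V → ℝ) :
    y ⬝ᵥ (lapMat ε *ᵥ y) = ∑ u, ∑ v, ε u v * (y u * y u - y u * y v) := by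
  rw [lapMat, Matrix.sub_mulVec, dotProduct]
  refine Finset.sum_congr rfl fun u _ => ?_
  rw [Pi.sub_apply, Matrix.mulVec_diagonal]
  simp only [Matrix.mulVec, dotProduct, Matrix.of_apply]
  rw [mul_sub, Finset.sum_mul, Finset.mul_sum, Finset.mul_sum, ← Finset.sum_sub_distrib]
  exact Finset.sum_congr rfl fun v _ => by ring

/-- The vectors `1 - k • 𝟙_j` on the set of `k` colours have Gram matrix `k ^ 2 • 1 - k • J`. -/
theorem sum_colour_vectors_mul {k : ℕ} (a b : Fin k) :
    ∑ j : Fin k, (1 - (k : ℝ) * if a = j then 1 else 0) * (1 - (k : ℝ) * if b = j then 1 else 0)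
      = (k : ℝ) ^ 2 * (if a = b then 1 else 0) - k := by
  have h : ∀ j : Fin k,
      (1 - (k : ℝ) * if a = j then 1 else 0) * (1 - (k : ℝ) * if b = j then 1 else 0)
      = 1 - (k : ℝ) * (if a = j then 1 else 0) - (k : ℝ) * (if b = j then 1 else 0)
        + (k : ℝ) ^ 2 * (if a = j then (if b = a then 1 else 0) else 0) := by
    intro j
    by_cases h1 : a = j
    · subst h1
      by_cases h2 : b = a
      · simp [h2]
        ring
      · simp [h2]
    · simp [h1]
  simp only [h, Finset.sum_add_distrib, Finset.sum_sub_distrib, ← Finset.mul_sum,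
    Finset.sum_ite_eq, Finset.mem_univ, if_true, Finset.sum_const, Finset.card_univ,
    Fintype.card_fin, nsmul_eq_mul, eq_comm (a := a) (b := b)]
  ring

theorem mul_le_of_quadratic_form_le {V : Type} [Fintype V] [DecidableEq V]
    {ε : V → V → ℝ} {υ : V → ℝ} {l : ℝ}
    (hl : ∀ y : V → ℝ, y ⬝ᵥ (lapMat ε *ᵥ y) ≤ l * ∑ v, υ v * y v ^ 2)
    {k : ℕ} (hk : 0 < k) (c : V → Fin k) (hc : ∀ u v, c u = c v → ε u v = 0) :
    (∑ u, ∑ v, ε u v) * (k : ℝ) ≤ (∑ v, υ v) * l * ((k : ℝ) - 1) := by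
  have hsum := Finset.sum_le_sum fun (j : Fin k) (_ : j ∈ Finset.univ) =>
    hl fun v => 1 - (k : ℝ) * if c v = j then 1 else 0
  have hleft : ∑ j : Fin k, (fun v => 1 - (k : ℝ) * if c v = j then 1 else 0) ⬝ᵥ
      (lapMat ε *ᵥ fun v => 1 - (k : ℝ) * if c v = j then 1 else 0)
      = (k : ℝ) ^ 2 * ∑ u, ∑ v, ε u v := by
    simp only [dotProduct_lapMat_mulVec, Finset.mul_sum]
    rw [Finset.sum_comm]
    refine Finset.sum_congr rfl fun u _ => ?_
    rw [Finset.sum_comm]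
    refine Finset.sum_congr rfl fun v _ => ?_
    rw [← Finset.mul_sum, Finset.sum_sub_distrib, sum_colour_vectors_mul, sum_colour_vectors_mul]
    by_cases h : c u = c v
    · simp [hc u v h]
    · simp [h]; ring
  have hright : ∑ j : Fin k, l * ∑ v, υ v * (1 - (k : ℝ) * if c v = j then 1 else 0) ^ 2
      = l * ((∑ v, υ v) * ((k : ℝ) ^ 2 - k)) := by
    rw [← Finset.mul_sum, Finset.sum_comm, Finset.sum_mul]
    congr 1
    refine Finset.sum_congr rfl fun v _ => ?_
    simp only [pow_two (1 - (k : ℝ) * _)]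
    rw [← Finset.mul_sum, sum_colour_vectors_mul]
    simp
  rw [hleft, hright] at hsum
  have hk' : (0 : ℝ) < k := by exact_mod_cast hk
  refine le_of_mul_le_mul_left ?_ hk'
  linarith

/-- **Weighted spectral bound on the chromatic number**:
`λₙ > m/υ(V)` and `χ ≥ λₙ/(λₙ - m/υ(V))`; equivalently `m·χ ≤ υ(V)·λₙ·(χ-1)`. -/
theorem weighted_chromatic_bound
    {V : Type} [Fintype V] [DecidableEq V]
    (ε : V → V → ℝ) (hsym : ∀ u v, ε u v = ε v u)
    (hnonneg : ∀ u v, 0 ≤ ε u v) (hdiag : ∀ v, ε v v = 0)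
    (υ : V → ℝ) (hυ : ∀ v, 0 < υ v)
    (n : ℕ) (hn : n = Fintype.card V)
    (hedge : ∃ u v : V, u ≠ v ∧ 0 < ε u v)
    (lam : Fin n → ℝ) (hlamMono : Monotone lam)
    (hlam : (wlap ε υ).charpoly = ∏ i, (X - C (lam i)))
    (m : ℝ) (hm : m = ∑ u, ∑ v, ε u v)
    (χ : ℕ)
    (hχ : (SimpleGraph.fromRel fun u v : V => 0 < ε u v).chromaticNumber = (χ : ℕ∞)) :
    ∀ i : Fin n, (i : ℕ) + 1 = n →
      m / (∑ v, υ v) < lam i ∧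
      lam i / (lam i - m / (∑ v, υ v)) ≤ (χ : ℝ) ∧
      m * (χ : ℝ) ≤ (∑ v, υ v) * lam i * ((χ : ℝ) - 1) := by
  intro i hi
  obtain ⟨u₀, v₀, huv, hpos⟩ := hedge
  have hmax : ∀ x, (wlap ε υ).charpoly.IsRoot x → x ≤ lam i := by
    intro x hx
    rw [hlam, Polynomial.IsRoot.def, Polynomial.eval_prod, Finset.prod_eq_zero_iff] at hx
    obtain ⟨j, -, hj⟩ := hx
    rw [Polynomial.eval_sub, Polynomial.eval_X, Polynomial.eval_C, sub_eq_zero] at hj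
    rw [hj]
    exact hlamMono (Fin.le_def.2 (by omega))
  obtain ⟨c⟩ := SimpleGraph.chromaticNumber_le_iff_colorable.1 hχ.le
  have hc : ∀ u v, c u = c v → ε u v = 0 := by
    intro u v h
    by_contra hne
    have huv' : u ≠ v := by
      rintro rfl
      exact hne (hdiag u)
    exact c.valid ((SimpleGraph.fromRel_adj _ _ _).2
      ⟨huv', Or.inl (lt_of_le_of_ne (hnonneg u v) (Ne.symm hne))⟩) h
  have hk : 0 < χ := Fin.pos (c u₀)
  have hbound := mul_le_of_quadratic_form_le (wlap_quadratic_form_le hsym hυ hmax) hk c hc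
  rw [← hm] at hbound
  have hm0 : 0 < m := by
    rw [hm]
    exact Finset.sum_pos' (fun u _ => Finset.sum_nonneg fun v _ => hnonneg u v)
      ⟨u₀, Finset.mem_univ _, Finset.sum_pos' (fun v _ => hnonneg u₀ v)
        ⟨v₀, Finset.mem_univ _, hpos⟩⟩
  have hS : 0 < ∑ v, υ v := Finset.sum_pos (fun v _ => hυ v) ⟨u₀, Finset.mem_univ _⟩
  set S := ∑ v, υ v
  have hχ1 : (1 : ℝ) ≤ χ := by exact_mod_cast hk
  have hlam0 : 0 < S * lam i := by
    by_contra! h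
    nlinarith [mul_pos hm0 (zero_lt_one.trans_le hχ1),
      mul_nonneg (neg_nonneg.2 h) (sub_nonneg.2 hχ1)]
  have hlt : m / S < lam i := by
    rw [div_lt_iff₀ hS]
    refine lt_of_mul_lt_mul_right ?_ (zero_le_one.trans hχ1)
    nlinarith
  refine ⟨hlt, ?_, hbound⟩
  rw [div_le_iff₀ (sub_pos.2 hlt)]
  have hdiv : m / S * χ ≤ lam i * (χ - 1) := by
    rw [div_mul_eq_mul_div, div_le_iff₀ hS]
    linarith
  linarith
end

section
/- Let ε be an edge-weight function on a finite set V with n = |V|, suppose there exist distinct u,v ∈ V with ε(u,v) > 0, and let λ_n be the largest eigenvalue of the combinatorial Laplacian L(ε). Let d̄ = (∑_{v ∈ V} d_ε(v))/n be the average degree and χ the chromatic number of G(ε). Then λ_n > d̄ and χ ≥ λ_n / (λ_n − d̄). -/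
open Matrix Polynomial
open scoped Classical

/-- The Rayleigh quotient of a real symmetric matrix is at most any upper bound of the roots of its
characteristic polynomial. -/
lemma dotProduct_mulVec_le_of_charpoly {V ι : Type*} [Fintype V] [DecidableEq V] [Fintype ι]
    {A : Matrix V V ℝ} (hA : A.IsHermitian) {lam : ι → ℝ}
    (hlam : A.charpoly = ∏ i, (X - C (lam i))) {μ : ℝ} (hμ : ∀ i, lam i ≤ μ) (x : V → ℝ) :
    x ⬝ᵥ A *ᵥ x ≤ μ * (x ⬝ᵥ x) := by
  have hpsd : (algebraMap ℝ (Matrix V V ℝ) μ - A).PosSemidef := by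
    rw [posSemidef_iff_isHermitian_and_spectrum_nonneg]
    refine ⟨IsHermitian.sub ?_ hA, ?_⟩
    · rw [algebraMap_eq_diagonal]
      exact isHermitian_diagonal _
    · rw [← spectrum.singleton_sub_eq]
      rintro _ ⟨a, rfl, b, hb, rfl⟩
      rw [mem_spectrum_iff_isRoot_charpoly, hlam, IsRoot.def, eval_prod,
        Finset.prod_eq_zero_iff] at hb
      obtain ⟨i, -, hi⟩ := hb
      have := hμ i
      simp only [eval_sub, eval_X, eval_C] at hi
      simp only [Set.mem_ofPred_eq]
      linarith
  have h := hpsd.dotProduct_mulVec_nonneg x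
  rw [star_trivial, sub_mulVec, dotProduct_sub, Algebra.algebraMap_eq_smul_one, smul_mulVec, one_mulVec,
    dotProduct_smul, smul_eq_mul] at h
  linarith

lemma isHermitian_lapMat {V : Type} [Fintype V] [DecidableEq V] {ε : V → V → ℝ}
    (hsym : ∀ u v, ε u v = ε v u) : (lapMat ε).IsHermitian :=
  (isHermitian_diagonal _).sub (IsHermitian.ext fun u v => by simp [hsym u v])

lemma two_mul_dotProduct_lapMat_mulVec {V : Type} [Fintype V] [DecidableEq V] {ε : V → V → ℝ}
    (hsym : ∀ u v, ε u v = ε v u) (x : V → ℝ) :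
    2 * (x ⬝ᵥ lapMat ε *ᵥ x) = ∑ v, ∑ u, ε v u * (x v - x u) ^ 2 := by
  have hquad : x ⬝ᵥ lapMat ε *ᵥ x = ∑ v, ∑ u, ε v u * (x v * (x v - x u)) := by
    rw [lapMat, sub_mulVec, dotProduct_sub]
    simp only [dotProduct, mulVec_diagonal, Finset.sum_mul, Finset.mul_sum]
    simp only [mulVec, dotProduct, of_apply, Finset.mul_sum, ← Finset.sum_sub_distrib]
    exact Finset.sum_congr rfl fun v _ => Finset.sum_congr rfl fun u _ => by ring
  have hswap : x ⬝ᵥ lapMat ε *ᵥ x = ∑ v, ∑ u, ε v u * (x u * (x u - x v)) := by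
    rw [hquad, Finset.sum_comm]
    exact Finset.sum_congr rfl fun v _ => Finset.sum_congr rfl fun u _ => by rw [hsym]
  rw [two_mul]
  nth_rewrite 1 [hquad]
  rw [hswap]
  simp only [← Finset.sum_add_distrib]
  exact Finset.sum_congr rfl fun v _ => Finset.sum_congr rfl fun u _ => by ring

/-- The Rayleigh bound for the Laplacian, improved by projecting off the constant vector. -/
lemma sum_mul_sq_sub_le {V : Type} [Fintype V] [DecidableEq V] [Nonempty V] {ε : V → V → ℝ}
    (hsym : ∀ u v, ε u v = ε v u) {μ : ℝ}
    (hμ : ∀ x : V → ℝ, x ⬝ᵥ lapMat ε *ᵥ x ≤ μ * (x ⬝ᵥ x)) (x : V → ℝ) :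
    ∑ v, ∑ u, ε v u * (x v - x u) ^ 2 ≤
      2 * μ * (∑ v, x v ^ 2 - (∑ v, x v) ^ 2 / Fintype.card V) := by
  have hcard : (Fintype.card V : ℝ) ≠ 0 := by exact_mod_cast Fintype.card_ne_zero
  set m : ℝ := (∑ v, x v) / Fintype.card V with hm
  have hnorm : (fun v => x v - m) ⬝ᵥ (fun v => x v - m) =
      ∑ v, x v ^ 2 - (∑ v, x v) ^ 2 / Fintype.card V := by
    have hexp : ∀ v, (x v - m) * (x v - m) = x v ^ 2 - 2 * m * x v + m ^ 2 := fun v => by ring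
    simp only [dotProduct, hexp, Finset.sum_add_distrib, Finset.sum_sub_distrib,
      ← Finset.mul_sum, Finset.sum_const, Finset.card_univ, nsmul_eq_mul]
    rw [hm]
    field_simp
    ring
  have h := hμ fun v => x v - m
  have hq := two_mul_dotProduct_lapMat_mulVec hsym fun v => x v - m
  simp only [sub_sub_sub_cancel_right] at hq
  rw [hnorm] at h
  linarith

/-- Summing the improved Rayleigh bound over the indicators of the classes of a colouring. -/
lemma sum_le_of_coloring {V κ : Type} [Fintype V] [DecidableEq V] [Nonempty V] [Fintype κ]
    [DecidableEq κ] {ε : V → V → ℝ} (hsym : ∀ u v, ε u v = ε v u) {μ : ℝ}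
    (hμ : ∀ x : V → ℝ, x ⬝ᵥ lapMat ε *ᵥ x ≤ μ * (x ⬝ᵥ x))
    (c : V → κ) (hc : ∀ u v, c u = c v → ε u v = 0) :
    ∑ v, ∑ u, ε v u ≤ μ * (Fintype.card V -
      (∑ k, (∑ v, if c v = k then (1 : ℝ) else 0) ^ 2) / Fintype.card V) := by
  have hsum := Finset.sum_le_sum fun k (_ : k ∈ Finset.univ) =>
    sum_mul_sq_sub_le hsym hμ fun v => if c v = k then (1 : ℝ) else 0
  have hleft : ∑ k, ∑ v, ∑ u, ε v u *
      ((if c v = k then (1 : ℝ) else 0) - if c u = k then (1 : ℝ) else 0) ^ 2 =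
      2 * ∑ v, ∑ u, ε v u := by
    rw [Finset.sum_comm, Finset.mul_sum]
    refine Finset.sum_congr rfl fun v _ => ?_
    rw [Finset.sum_comm, Finset.mul_sum]
    refine Finset.sum_congr rfl fun u _ => ?_
    rw [← Finset.mul_sum]
    by_cases h : c v = c u
    · simp [hc v u h]
    · have hexp : ∀ k, ((if c v = k then (1 : ℝ) else 0) - if c u = k then (1 : ℝ) else 0) ^ 2 =
          (if c v = k then (1 : ℝ) else 0) + if c u = k then (1 : ℝ) else 0 := by
        intro k
        split_ifs with h₁ h₂
        · exact absurd (h₁.trans h₂.symm) h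
        all_goals norm_num
      simp only [hexp, Finset.sum_add_distrib, Finset.sum_ite_eq, Finset.mem_univ, if_true]
      ring
  have hsq : ∑ k, ∑ v, (if c v = k then (1 : ℝ) else 0) ^ 2 = Fintype.card V := by
    rw [Finset.sum_comm]
    simp
  rw [hleft, ← Finset.mul_sum, Finset.sum_sub_distrib, hsq, ← Finset.sum_div] at hsum
  linarith

/-- **Combinatorial Laplacian bound on the chromatic number**:
`λₙ > d̄` and `χ ≥ λₙ/(λₙ - d̄)`, where `d̄` is the average degree. -/
theorem combinatorial_chromatic_bound
    {V : Type} [Fintype V] [DecidableEq V]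
    (ε : V → V → ℝ) (hsym : ∀ u v, ε u v = ε v u)
    (hnonneg : ∀ u v, 0 ≤ ε u v) (hdiag : ∀ v, ε v v = 0)
    (n : ℕ) (hn : n = Fintype.card V)
    (hedge : ∃ u v : V, u ≠ v ∧ 0 < ε u v)
    (lam : Fin n → ℝ) (hlamMono : Monotone lam)
    (hlam : (lapMat ε).charpoly = ∏ i, (X - C (lam i)))
    (dbar : ℝ) (hdbar : dbar = (∑ v, ∑ u, ε v u) / n)
    (χ : ℕ)
    (hχ : (SimpleGraph.fromRel fun u v : V => 0 < ε u v).chromaticNumber = (χ : ℕ∞)) :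
    ∀ i : Fin n, (i : ℕ) + 1 = n →
      dbar < lam i ∧ lam i / (lam i - dbar) ≤ (χ : ℝ) := by
  intro i hi
  obtain ⟨a, b, -, hab⟩ := hedge
  have : Nonempty V := ⟨a⟩
  have hcard : (0 : ℝ) < Fintype.card V := by exact_mod_cast Fintype.card_pos
  have hmax : ∀ j, lam j ≤ lam i := fun j => hlamMono (Fin.le_def.2 (by omega))
  have hray := dotProduct_mulVec_le_of_charpoly (isHermitian_lapMat hsym) hlam hmax
  obtain ⟨c⟩ := SimpleGraph.chromaticNumber_le_iff_colorable.1 hχ.le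
  have hc : ∀ u v, c u = c v → ε u v = 0 := by
    intro u v huv
    by_contra hne
    refine c.valid ?_ huv
    rw [SimpleGraph.fromRel_adj]
    exact ⟨fun h => hne (h ▸ hdiag u), Or.inl ((hnonneg u v).lt_of_ne' hne)⟩
  have hle := sum_le_of_coloring hsym hray c hc
  have hχ0 : (0 : ℝ) < χ := by exact_mod_cast (c a).pos
  have hcs := sq_sum_le_card_mul_sum_sq (s := Finset.univ)
    (f := fun k => ∑ v, if c v = k then (1 : ℝ) else 0)
  have htot : ∑ k, ∑ v, (if c v = k then (1 : ℝ) else 0) = Fintype.card V := by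
    rw [Finset.sum_comm]
    simp
  rw [htot, Finset.card_univ, Fintype.card_fin] at hcs
  have hpos : 0 < ∑ v, ∑ u, ε v u :=
    Finset.sum_pos' (fun v _ => Finset.sum_nonneg fun u _ => hnonneg v u)
      ⟨a, Finset.mem_univ a, Finset.sum_pos' (fun u _ => hnonneg a u) ⟨b, Finset.mem_univ b, hab⟩⟩
  have hdpos : 0 < dbar := by rw [hdbar, hn]; positivity
  have hsum : ∑ v, ∑ u, ε v u = dbar * Fintype.card V := by
    rw [hdbar, hn]; field_simp
  rw [hsum] at hle
  set N : ℝ := (Fintype.card V : ℝ)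
  set S : ℝ := ∑ k, (∑ v, if c v = k then (1 : ℝ) else 0) ^ 2
  have hS0 : 0 ≤ S := Finset.sum_nonneg fun k _ => sq_nonneg _
  have hSle : S ≤ N ^ 2 := by
    rw [← htot]
    exact Finset.sum_sq_le_sq_sum_of_nonneg fun k _ =>
      Finset.sum_nonneg fun v _ => by positivity
  have hgap : 0 ≤ N - S / N := by
    rw [sub_nonneg, div_le_iff₀ hcard]
    nlinarith
  have hlampos : 0 < lam i := pos_of_mul_pos_left ((mul_pos hdpos hcard).trans_le hle) hgap
  have hSge : N / χ ≤ S / N := by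
    rw [div_le_div_iff₀ hχ0 hcard]
    linarith
  have hkey : dbar ≤ lam i - lam i / χ := by
    refine le_of_mul_le_mul_right (hle.trans ?_) hcard
    calc lam i * (N - S / N) ≤ lam i * (N - N / χ) := by gcongr
      _ = (lam i - lam i / χ) * N := by ring
  have hdiv : 0 < lam i / χ := div_pos hlampos hχ0
  have hlt : dbar < lam i := by linarith
  refine ⟨hlt, ?_⟩
  rw [div_le_iff₀ (sub_pos.2 hlt), mul_comm, ← div_le_iff₀ hχ0]
  linarith
end
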